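/- Let 3 ≤ k = o(n), let δ > 0 be a constant, and let the population size satisfy µ ≥ c·k·ln n for a sufficiently large constant c > 0. Then the (µ+1) GA with uniform crossover, crossover probability p_c = 1, standard bit mutation with mutation rate (1+δ)/n, and uniform tie-breaking in replacement selection, has expected optimization time O(µ² + n^{k−1}) on Jump_k. -/

import Mathlib

open Filter
open scoped ENNReal BigOperators Classical

noncomputable section

abbrev BitString (n : ℕ) := Fin n → Bool

def onesCount {n : ℕ} (x : BitString n) : ℕ := (Finset.univ.filter fun i => x i = true).card

def allOnes (n : ℕ) : BitString n := fun _ => true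
def allZeros (n : ℕ) : BitString n := fun _ => false

def twoMax {n : ℕ} (x : BitString n) : ℕ := max (onesCount x) (n - onesCount x)

/-- probability that standard bit mutation with rate `1/n` creates `y` from `x` -/
def mutProb (n : ℕ) (x y : BitString n) : ℝ≥0∞ :=
  ((n : ℝ≥0∞)⁻¹) ^ hammingDist x y * (1 - (n : ℝ≥0∞)⁻¹) ^ (n - hammingDist x y)

/-- distribution of a (time-homogeneous) finite Markov chain after `t` steps -/
def evolve {S : Type*} [Fintype S] (init : S → ℝ≥0∞) (trans : S → S → ℝ≥0∞) : ℕ → S → ℝ≥0∞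
  | 0 => init
  | t + 1 => fun s' => ∑ s, evolve init trans t s * trans s s'

/-- probability of an event under a (sub)distribution -/
def probOf {S : Type*} [Fintype S] (d : S → ℝ≥0∞) (A : S → Prop) : ℝ≥0∞ :=
  ∑ s, if A s then d s else 0

end

noncomputable section

namespace Jump

/-- the fitness function Jump_k -/
def jump (n k : ℕ) (x : BitString n) : ℕ :=
  if onesCount x = n ∨ onesCount x ≤ n - k then k + onesCount x else n - onesCount x

/-- probability that standard bit mutation with mutation rate `p` creates `y` from `x` -/
def mutP (n : ℕ) (p : ℝ) (x y : BitString n) : ℝ≥0∞ :=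
  ENNReal.ofReal p ^ hammingDist x y * ENNReal.ofReal (1 - p) ^ (n - hammingDist x y)

/-- probability mass of uniform crossover of u and v producing `mid` -/
def crossMass {n : ℕ} (u v mid : BitString n) : ℝ≥0∞ :=
  ∏ i, (if u i = v i then (if mid i = u i then 1 else 0) else (2 : ℝ≥0∞)⁻¹)

/-- the population obtained from P ∪ {y} by removing individual `j` -/
def removeAt {n μ : ℕ} (P : Fin μ → BitString n) (y : BitString n) (j : Fin (μ + 1)) :
    Fin μ → BitString n :=
  if h : j.val < μ then Function.update P ⟨j.val, h⟩ y else P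

/-- State of a run: the current population together with a flag recording whether the
global optimum 1ⁿ has been created (as an initial member or as an offspring). -/
abbrev State (n μ : ℕ) := (Fin μ → BitString n) × Bool

/-- One generation of the (μ+1) GA on Jump_k with crossover probability p_c = 1 and
mutation rate `p`: two parents are chosen independently and uniformly at random, an
offspring is created by uniform crossover followed by standard bit mutation, and one
individual of worst fitness among population and offspring, chosen uniformly at
random, is removed. -/
def trans (n μ k : ℕ) (p : ℝ) : State n μ → State n μ → ℝ≥0∞ := fun s s' =>
  ∑ i₁ : Fin μ, ∑ i₂ : Fin μ, ((μ : ℝ≥0∞)⁻¹ * (μ : ℝ≥0∞)⁻¹) *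
    ∑ mid : BitString n, crossMass (s.1 i₁) (s.1 i₂) mid *
      ∑ y : BitString n, mutP n p mid y *
        (let all : Fin (μ + 1) → BitString n := Fin.snoc s.1 y
         let worst : Finset (Fin (μ + 1)) :=
           Finset.univ.filter fun j => ∀ i', jump n k (all j) ≤ jump n k (all i')
         ∑ j ∈ worst, (worst.card : ℝ≥0∞)⁻¹ *
           (if s'.1 = removeAt s.1 y j ∧ s'.2 = (s.2 || decide (y = allOnes n))
             then 1 else 0))

/-- Initialization: uniform over all populations of μ bit strings of length n. -/
def init (n μ : ℕ) : State n μ → ℝ≥0∞ := fun s =>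
  ((2 : ℝ≥0∞) ^ (n * μ))⁻¹ * (if s.2 = decide (∃ i, s.1 i = allOnes n) then 1 else 0)

/-- expected number of generations until the global optimum 1ⁿ of Jump_k is created -/
def expOpt (n μ k : ℕ) (p : ℝ) : ℝ≥0∞ :=
  ∑' T : ℕ, probOf (evolve (init n μ) (trans n μ k p) T) fun s => ¬ s.2 = true

end Jump

noncomputable section

namespace Jump

/-! ### Lyapunov lemma -/

lemma lyap {S : Type*} [Fintype S] (ini : S → ℝ≥0∞) (tr : S → S → ℝ≥0∞) (V : S → ℝ≥0∞)
    (I A : S → Prop) (hI0 : ∀ s, ini s ≠ 0 → I s)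
    (hI : ∀ s s', I s → tr s s' ≠ 0 → I s')
    (hV : ∀ s, I s → (if A s then 1 else 0) + ∑ s', tr s s' * V s' ≤ V s) :
    ∑' T : ℕ, probOf (evolve ini tr T) A ≤ ∑ s, ini s * V s := by
  have hsupp : ∀ T s, evolve ini tr T s ≠ 0 → I s := by
    intro T
    induction T with
    | zero => exact hI0
    | succ T ih =>
      intro s hs
      simp only [evolve] at hs
      obtain ⟨s0, -, h0⟩ := Finset.exists_ne_zero_of_sum_ne_zero hs
      exact hI s0 s (ih s0 (left_ne_zero_of_mul h0)) (right_ne_zero_of_mul h0)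
  have key : ∀ T, ∑ t ∈ Finset.range T, probOf (evolve ini tr t) A
      + ∑ s, evolve ini tr T s * V s ≤ ∑ s, ini s * V s := by
    intro T
    induction T with
    | zero => simp [evolve]
    | succ T ih =>
      refine le_trans ?_ ih
      rw [Finset.sum_range_succ, add_assoc]
      gcongr
      have e1 : ∑ s, evolve ini tr (T + 1) s * V s
          = ∑ s, evolve ini tr T s * ∑ s', tr s s' * V s' := by
        simp only [evolve, Finset.sum_mul, Finset.mul_sum]
        rw [Finset.sum_comm]
        simp only [mul_assoc]
      rw [e1, probOf, ← Finset.sum_add_distrib]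
      refine Finset.sum_le_sum fun s _ => ?_
      by_cases hs : evolve ini tr T s = 0
      · simp [hs]
      · have := hV s (hsupp T s hs)
        calc _ = evolve ini tr T s * ((if A s then 1 else 0) + ∑ s', tr s s' * V s') := by
              rw [mul_add]; split_ifs <;> simp
          _ ≤ _ := by gcongr
  refine ENNReal.tsum_le_of_sum_range_le fun T => ?_
  exact le_trans le_self_add (key T)

/-! ### The kernel -/

/-- probability that crossover followed by mutation produces `y` from `u`, `v` -/
def pm {n : ℕ} (p : ℝ) (u v y : BitString n) : ℝ :=
  ∏ i, if u i = v i then (if y i = u i then 1 - p else p) else 1 / 2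

lemma mutP_eq {n : ℕ} (p : ℝ) (x y : BitString n) :
    mutP n p x y = ∏ i, if x i = y i then ENNReal.ofReal (1 - p) else ENNReal.ofReal p := by
  rw [Finset.prod_ite]
  simp only [Finset.prod_const, mutP, hammingDist]
  rw [mul_comm]
  congr 2
  have := Finset.card_filter_add_card_filter_not (s := (Finset.univ : Finset (Fin n))) (fun i => x i = y i)
  simp only [Finset.card_univ, Fintype.card_fin] at this
  have h2 : (Finset.univ.filter fun i => x i ≠ y i).card = (Finset.univ.filter fun i => ¬ x i = y i).card := rfl
  convert (by omega : n - (Finset.univ.filter fun i => ¬ x i = y i).card = (Finset.univ.filter fun i => x i = y i).card) using 3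

lemma prod_sum_bool {n : ℕ} {R : Type*} [CommSemiring R] (f : Fin n → Bool → R) :
    ∑ y : BitString n, ∏ i, f i (y i) = ∏ i, (f i true + f i false) := by
  have := Finset.prod_univ_sum (fun _ : Fin n => (Finset.univ : Finset Bool)) f
  rw [Fintype.piFinset_univ] at this
  rw [← this]
  simp

lemma pm_kernel {n : ℕ} (p : ℝ) (h0 : 0 ≤ p) (h1 : p ≤ 1) (u v y : BitString n) :
    ∑ mid, crossMass u v mid * mutP n p mid y = ENNReal.ofReal (pm p u v y) := by
  let f : Fin n → Bool → ℝ≥0∞ := fun i b =>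
      (if u i = v i then (if b = u i then 1 else 0) else (2 : ℝ≥0∞)⁻¹) *
      (if b = y i then ENNReal.ofReal (1 - p) else ENNReal.ofReal p)
  have e : ∀ mid, crossMass u v mid * mutP n p mid y = ∏ i, f i (mid i) := by
    intro mid
    rw [mutP_eq, crossMass, ← Finset.prod_mul_distrib]
  rw [Finset.sum_congr rfl (fun mid _ => e mid), prod_sum_bool f, pm,
    ENNReal.ofReal_prod_of_nonneg]
  · refine Finset.prod_congr rfl fun i _ => ?_
    have hs : ENNReal.ofReal (1 - p) + ENNReal.ofReal p = 1 := by
      rw [← ENNReal.ofReal_add (by linarith) h0]; simp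
    have hs' : ENNReal.ofReal p + ENNReal.ofReal (1 - p) = 1 := by
      rw [add_comm, hs]
    have hh : ENNReal.ofReal (1/2) = (2:ℝ≥0∞)⁻¹ := by
      rw [one_div, ENNReal.ofReal_inv_of_pos (by norm_num)]; simp
    simp only [f]
    by_cases huv : u i = v i
    · rcases hu : u i <;> rcases hy : y i <;> simp [← huv, hu]
    · simp only [huv, if_false, hh]
      rcases hy : y i <;> simp [← mul_add, hs, hs']
  · intro i _
    split_ifs <;> linarith

lemma pm_nonneg {n : ℕ} {p : ℝ} (h0 : 0 ≤ p) (h1 : p ≤ 1) (u v y : BitString n) :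
    0 ≤ pm p u v y := by
  refine Finset.prod_nonneg fun i _ => ?_
  split_ifs <;> linarith

lemma pm_sum {n : ℕ} (p : ℝ) (u v : BitString n) : ∑ y, pm p u v y = 1 := by
  have := prod_sum_bool (R := ℝ) (fun (i : Fin n) b => if u i = v i then (if b = u i then 1 - p else p) else 1 / 2)
  simp only [pm]
  rw [this]
  refine Finset.prod_eq_one fun i _ => ?_
  by_cases huv : u i = v i
  · rcases hu : u i <;> simp [← huv, hu]
  · simp [huv]; norm_num

/-- offspring distribution -/
def off {n μ : ℕ} (p : ℝ) (P : Fin μ → BitString n) (y : BitString n) : ℝ :=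
  ∑ i₁, ∑ i₂, ((μ : ℝ)⁻¹ * (μ : ℝ)⁻¹) * pm p (P i₁) (P i₂) y

lemma off_nonneg {n μ : ℕ} {p : ℝ} (h0 : 0 ≤ p) (h1 : p ≤ 1) (P : Fin μ → BitString n)
    (y : BitString n) : 0 ≤ off p P y :=
  Finset.sum_nonneg fun _ _ => Finset.sum_nonneg fun _ _ =>
    mul_nonneg (by positivity) (pm_nonneg h0 h1 _ _ _)

lemma off_sum_mul {n μ : ℕ} (p : ℝ) (P : Fin μ → BitString n) (F : BitString n → ℝ) :
    ∑ y, off p P y * F y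
      = ∑ i₁, ∑ i₂, ((μ : ℝ)⁻¹ * (μ : ℝ)⁻¹) * ∑ y, pm p (P i₁) (P i₂) y * F y := by
  simp only [off, Finset.sum_mul, Finset.mul_sum]
  rw [Finset.sum_comm]
  refine Finset.sum_congr rfl fun i _ => ?_
  rw [Finset.sum_comm]
  simp only [mul_assoc]

lemma off_sum {n μ : ℕ} (hμ : 1 ≤ μ) (p : ℝ) (P : Fin μ → BitString n) : ∑ y, off p P y = 1 := by
  have := off_sum_mul p P (fun _ => 1)
  simp only [mul_one, pm_sum] at this
  rw [this]
  have : (μ : ℝ) ≠ 0 := by positivity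
  simp
  field_simp

/-- indices of worst individuals of the extended population -/
def worst {n μ : ℕ} (k : ℕ) (P : Fin μ → BitString n) (y : BitString n) : Finset (Fin (μ + 1)) :=
  Finset.univ.filter fun j => ∀ i', jump n k ((Fin.snoc P y : Fin (μ + 1) → BitString n) j)
    ≤ jump n k ((Fin.snoc P y : Fin (μ + 1) → BitString n) i')

lemma worst_nonempty {n μ : ℕ} (k : ℕ) (P : Fin μ → BitString n) (y : BitString n) :
    (worst k P y).Nonempty := by
  obtain ⟨j, -, hj⟩ := Finset.exists_min_image Finset.univ
    (fun j => jump n k ((Fin.snoc P y : Fin (μ + 1) → BitString n) j)) ⟨0, Finset.mem_univ _⟩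
  exact ⟨j, by simp only [worst, Finset.mem_filter, Finset.mem_univ, true_and]; exact fun i => hj i (Finset.mem_univ _)⟩

/-- average over the removed individual -/
def avg {n μ : ℕ} (k : ℕ) (P : Fin μ → BitString n) (y : BitString n) (F : Fin (μ + 1) → ℝ) : ℝ :=
  ∑ j ∈ worst k P y, ((worst k P y).card : ℝ)⁻¹ * F j

lemma avg_le {n μ : ℕ} {k : ℕ} {P : Fin μ → BitString n} {y : BitString n} {F : Fin (μ + 1) → ℝ}
    {c : ℝ} (h : ∀ j ∈ worst k P y, F j ≤ c) : avg k P y F ≤ c := by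
  have hc : 0 < ((worst k P y).card : ℝ) := by exact_mod_cast (worst_nonempty k P y).card_pos
  calc avg k P y F ≤ ∑ j ∈ worst k P y, ((worst k P y).card : ℝ)⁻¹ * c := by
        refine Finset.sum_le_sum fun j hj => ?_
        exact mul_le_mul_of_nonneg_left (h j hj) (by positivity)
    _ = c := by rw [Finset.sum_const, nsmul_eq_mul]; field_simp

lemma sum_push {S ι : Type*} [Fintype S] (t : Finset ι) (c : ι → ℝ≥0∞) (f : ι → S → ℝ≥0∞) (V : S → ℝ≥0∞) :
    ∑ s, (∑ i ∈ t, c i * f i s) * V s = ∑ i ∈ t, c i * ∑ s, f i s * V s := by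
  simp only [Finset.sum_mul, Finset.mul_sum]
  rw [Finset.sum_comm]
  simp only [mul_assoc]

lemma sum_push' {S ι : Type*} [Fintype S] (t : Finset ι) (f : ι → S → ℝ≥0∞) (V : S → ℝ≥0∞) :
    ∑ s, (∑ i ∈ t, f i s) * V s = ∑ i ∈ t, ∑ s, f i s * V s := by
  simp only [Finset.sum_mul]
  rw [Finset.sum_comm]

lemma trans_sum0 {n μ k : ℕ} (p : ℝ) (s : State n μ) (V : State n μ → ℝ≥0∞) :
    ∑ s', trans n μ k p s s' * V s' =
    ∑ i₁ : Fin μ, ∑ i₂ : Fin μ, ((μ : ℝ≥0∞)⁻¹ * (μ : ℝ≥0∞)⁻¹) *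
    ∑ mid : BitString n, crossMass (s.1 i₁) (s.1 i₂) mid *
      ∑ y : BitString n, mutP n p mid y *
        ∑ j ∈ worst k s.1 y, ((worst k s.1 y).card : ℝ≥0∞)⁻¹ *
          V (removeAt s.1 y j, s.2 || decide (y = allOnes n)) := by
  simp only [trans]
  rw [sum_push']
  refine Finset.sum_congr rfl fun i₁ _ => ?_
  rw [sum_push]
  refine Finset.sum_congr rfl fun i₂ _ => ?_
  congr 1
  rw [sum_push]
  refine Finset.sum_congr rfl fun mid _ => ?_
  congr 1
  rw [sum_push]
  refine Finset.sum_congr rfl fun y _ => ?_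
  congr 1
  rw [sum_push]
  refine Finset.sum_congr rfl fun j _ => ?_
  congr 1
  rw [Finset.sum_eq_single (removeAt s.1 y j, s.2 || decide (y = allOnes n))]
  · simp
  · intro b _ hb
    rw [if_neg, zero_mul]
    rintro ⟨h1, h2⟩
    exact hb (Prod.ext h1 h2)
  · simp

lemma trans_sum {n μ k : ℕ} {p : ℝ} (hμ : 1 ≤ μ) (h0 : 0 ≤ p) (h1 : p ≤ 1) (s : State n μ)
    (v : State n μ → ℝ) (hv : ∀ s, 0 ≤ v s) :
    ∑ s', trans n μ k p s s' * ENNReal.ofReal (v s') =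
    ENNReal.ofReal (∑ y, off p s.1 y * avg k s.1 y fun j =>
      v (removeAt s.1 y j, s.2 || decide (y = allOnes n))) := by
  rw [trans_sum0, off_sum_mul, ENNReal.ofReal_sum_of_nonneg]
  have havg : ∀ y, ∑ j ∈ worst k s.1 y, ((worst k s.1 y).card : ℝ≥0∞)⁻¹ *
          ENNReal.ofReal (v (removeAt s.1 y j, s.2 || decide (y = allOnes n))) =
        ENNReal.ofReal (avg k s.1 y fun j =>
      v (removeAt s.1 y j, s.2 || decide (y = allOnes n))) := by
    intro y
    have hc : 0 < ((worst k s.1 y).card : ℝ) := by exact_mod_cast (worst_nonempty k s.1 y).card_pos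
    rw [avg, ENNReal.ofReal_sum_of_nonneg fun j _ => mul_nonneg (by positivity) (hv _)]
    refine Finset.sum_congr rfl fun j _ => ?_
    rw [ENNReal.ofReal_mul (by positivity), ENNReal.ofReal_inv_of_pos hc, ENNReal.ofReal_natCast]
  have hav0 : ∀ y, 0 ≤ avg k s.1 y fun j => v (removeAt s.1 y j, s.2 || decide (y = allOnes n)) :=
    fun y => Finset.sum_nonneg fun j _ => mul_nonneg (by positivity) (hv _)
  have hμ' : (0 : ℝ) < μ := by exact_mod_cast hμ
  have hin : ∀ i₁ i₂, 0 ≤ ∑ y, pm p (s.1 i₁) (s.1 i₂) y * avg k s.1 y fun j =>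
      v (removeAt s.1 y j, s.2 || decide (y = allOnes n)) :=
    fun i₁ i₂ => Finset.sum_nonneg fun y _ => mul_nonneg (pm_nonneg h0 h1 _ _ _) (hav0 y)
  · refine Finset.sum_congr rfl fun i₁ _ => ?_
    rw [ENNReal.ofReal_sum_of_nonneg fun i₂ _ => mul_nonneg (by positivity) (hin i₁ i₂)]
    refine Finset.sum_congr rfl fun i₂ _ => ?_
    rw [ENNReal.ofReal_mul (by positivity), ENNReal.ofReal_mul (by positivity),
      ENNReal.ofReal_inv_of_pos hμ', ENNReal.ofReal_natCast]
    congr 1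
    rw [ENNReal.ofReal_sum_of_nonneg fun y _ => mul_nonneg (pm_nonneg h0 h1 _ _ _) (hav0 y)]
    simp only [havg, Finset.mul_sum]
    rw [Finset.sum_comm]
    refine Finset.sum_congr rfl fun y _ => ?_
    rw [ENNReal.ofReal_mul (pm_nonneg h0 h1 _ _ _), ← pm_kernel p h0 h1, Finset.sum_mul]
    simp only [mul_assoc]
  · intro i₁ _
    refine Finset.sum_nonneg fun i₂ _ => mul_nonneg (by positivity) ?_
    exact Finset.sum_nonneg fun y _ => mul_nonneg (pm_nonneg h0 h1 _ _ _)
      (Finset.sum_nonneg fun j _ => mul_nonneg (by positivity) (hv _))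

/-- counting individuals with a property -/
def cnt {n μ : ℕ} (Q : BitString n → Prop) (P : Fin μ → BitString n) : ℕ :=
  (Finset.univ.filter fun i => Q (P i)).card

lemma cnt_eq {n μ : ℕ} (Q : BitString n → Prop) (P : Fin μ → BitString n) :
    cnt Q P = ∑ i, if Q (P i) then 1 else 0 := by
  simp [cnt]

lemma cnt_removeAt {n μ : ℕ} (Q : BitString n → Prop) (P : Fin μ → BitString n) (y : BitString n)
    (j : Fin (μ + 1)) :
    cnt Q (removeAt P y j) + (if Q ((Fin.snoc P y : Fin (μ + 1) → BitString n) j) then 1 else 0)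
      = cnt Q P + if Q y then 1 else 0 := by
  refine Fin.lastCases ?_ (fun i => ?_) j
  · simp [removeAt]
  · simp only [cnt_eq, removeAt, Fin.snoc_castSucc, Fin.val_castSucc, Fin.is_lt, dif_pos]
    rw [← Finset.add_sum_erase _ _ (Finset.mem_univ i),
      ← Finset.add_sum_erase _ (fun i => if Q (P i) then 1 else 0) (Finset.mem_univ i)]
    have : ∑ x ∈ Finset.univ.erase i, (if Q (Function.update P i y x) then 1 else 0)
        = ∑ x ∈ Finset.univ.erase i, if Q (P x) then 1 else 0 := by
      refine Finset.sum_congr rfl fun x hx => ?_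
      rw [Function.update_of_ne (Finset.ne_of_mem_erase hx)]
    simp only [Fin.eta, this, Function.update_self]
    ring

/-! ### Offspring masses -/

/-- number of zero bits -/
def zer {n : ℕ} (u : BitString n) : ℕ := (Finset.univ.filter fun i => u i = false).card

lemma ones_add_zer {n : ℕ} (u : BitString n) : onesCount u + zer u = n := by
  have := Finset.card_filter_add_card_filter_not (s := (Finset.univ : Finset (Fin n))) (fun i => u i = true)
  simp only [Finset.card_univ, Fintype.card_fin, Bool.not_eq_true] at this
  exact this

lemma zer_le {n : ℕ} (u : BitString n) : zer u ≤ n := by have := ones_add_zer u; omega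

lemma zer_eq_zero {n : ℕ} (u : BitString n) : zer u = 0 ↔ u = allOnes n := by
  simp only [zer, Finset.card_eq_zero, Finset.filter_eq_empty_iff, funext_iff, allOnes]
  simp

/-- number of common zeros -/
def cz {n : ℕ} (u v : BitString n) : ℕ := (Finset.univ.filter fun i => u i = v i ∧ u i = false).card

lemma zer_left {n : ℕ} (u v : BitString n) :
    zer u = cz u v + (Finset.univ.filter fun i => u i = false ∧ v i = true).card := by
  rw [zer, cz, ← Finset.card_union_of_disjoint]
  · congr 1; ext i
    simp only [Finset.mem_filter, Finset.mem_univ, true_and, Finset.mem_union]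
    rcases u i <;> rcases v i <;> simp
  · rw [Finset.disjoint_left]; intro i
    simp only [Finset.mem_filter, Finset.mem_univ, true_and]
    rcases u i <;> rcases v i <;> simp

lemma zer_right {n : ℕ} (u v : BitString n) :
    zer v = cz u v + (Finset.univ.filter fun i => u i = true ∧ v i = false).card := by
  rw [zer, cz, ← Finset.card_union_of_disjoint]
  · congr 1; ext i
    simp only [Finset.mem_filter, Finset.mem_univ, true_and, Finset.mem_union]
    rcases u i <;> rcases v i <;> simp
  · rw [Finset.disjoint_left]; intro i
    simp only [Finset.mem_filter, Finset.mem_univ, true_and]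
    rcases u i <;> rcases v i <;> simp

lemma ham_eq {n : ℕ} (u v : BitString n) :
    hammingDist u v = (Finset.univ.filter fun i => u i = false ∧ v i = true).card
      + (Finset.univ.filter fun i => u i = true ∧ v i = false).card := by
  rw [hammingDist, ← Finset.card_union_of_disjoint]
  · congr 1; ext i
    simp only [Finset.mem_filter, Finset.mem_univ, true_and, Finset.mem_union]
    rcases u i <;> rcases v i <;> simp
  · rw [Finset.disjoint_left]; intro i
    simp only [Finset.mem_filter, Finset.mem_univ, true_and]
    rcases u i <;> rcases v i <;> simp

lemma two_cz {n : ℕ} (u v : BitString n) : 2 * cz u v + hammingDist u v = zer u + zer v := by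
  rw [zer_left u v, zer_right u v, ham_eq]; ring

lemma pm_symm {n : ℕ} (p : ℝ) (u v y : BitString n) : pm p u v y = pm p v u y := by
  refine Finset.prod_congr rfl fun i _ => ?_
  by_cases h : u i = v i
  · simp [h]
  · simp [h, Ne.symm h]

lemma pm_ge {n : ℕ} {p : ℝ} (h0 : 0 ≤ p) (h1 : p ≤ 1) (u v y : BitString n) (m : ℕ)
    (hm : (Finset.univ.filter fun i => u i = v i ∧ y i ≠ u i).card = m) :
    (1 / 2) ^ hammingDist u v * p ^ m * (1 - p) ^ n ≤ pm p u v y := by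
  have e : pm p u v y = (1 / 2) ^ hammingDist u v * p ^ m * (1 - p) ^
      (Finset.univ.filter fun i => u i = v i ∧ y i = u i).card := by
    rw [pm, Finset.prod_ite, Finset.prod_const, Finset.prod_ite, Finset.prod_const, Finset.prod_const,
      Finset.filter_filter, Finset.filter_filter, hm]
    rw [hammingDist]
    ring
  rw [e]
  have : (Finset.univ.filter fun i => u i = v i ∧ y i = u i).card ≤ n := by
    simpa using Finset.card_le_univ (Finset.univ.filter fun i => u i = v i ∧ y i = u i)
  have h2 := pow_le_pow_of_le_one (by linarith : (0:ℝ) ≤ 1 - p) (by linarith) this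
  exact mul_le_mul_of_nonneg_left h2 (by positivity)

/-- probability that the offspring of `u`, `v` has property `Q` -/
def pr {n : ℕ} (p : ℝ) (u v : BitString n) (Q : BitString n → Prop) : ℝ :=
  ∑ y ∈ Finset.univ.filter Q, pm p u v y

lemma pr_symm {n : ℕ} (p : ℝ) (u v : BitString n) (Q) : pr p u v Q = pr p v u Q :=
  Finset.sum_congr rfl fun y _ => pm_symm p u v y

lemma pr_nonneg {n : ℕ} {p : ℝ} (h0 : 0 ≤ p) (h1 : p ≤ 1) (u v : BitString n) (Q) : 0 ≤ pr p u v Q :=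
  Finset.sum_nonneg fun y _ => pm_nonneg h0 h1 u v y

lemma pr_mono {n : ℕ} {p : ℝ} (h0 : 0 ≤ p) (h1 : p ≤ 1) (u v : BitString n) {Q R : BitString n → Prop}
    (h : ∀ y, Q y → R y) : pr p u v Q ≤ pr p u v R := by
  refine Finset.sum_le_sum_of_subset_of_nonneg ?_ fun y _ _ => pm_nonneg h0 h1 u v y
  intro y; simp only [Finset.mem_filter, Finset.mem_univ, true_and]; exact h y

lemma pr_le_one {n : ℕ} {p : ℝ} (h0 : 0 ≤ p) (h1 : p ≤ 1) (u v : BitString n) (Q) : pr p u v Q ≤ 1 := by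
  rw [← pm_sum p u v]
  exact Finset.sum_le_sum_of_subset_of_nonneg (Finset.subset_univ _) fun y _ _ => pm_nonneg h0 h1 u v y

lemma pr_ge {n : ℕ} {p : ℝ} (h0 : 0 ≤ p) (h1 : p ≤ 1) (u v : BitString n) {Q : BitString n → Prop}
    {ι : Type*} (T : Finset ι) (e : ι → BitString n) (he : Set.InjOn e T) (hQ : ∀ i ∈ T, Q (e i))
    {c : ℝ} (hc : ∀ i ∈ T, c ≤ pm p u v (e i)) : T.card * c ≤ pr p u v Q := by
  calc (T.card : ℝ) * c = ∑ i ∈ T, c := by simp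
    _ ≤ ∑ i ∈ T, pm p u v (e i) := Finset.sum_le_sum hc
    _ = ∑ y ∈ T.image e, pm p u v y := (Finset.sum_image he).symm
    _ ≤ _ := by
      refine Finset.sum_le_sum_of_subset_of_nonneg ?_ fun y _ _ => pm_nonneg h0 h1 u v y
      intro y
      simp only [Finset.mem_image, Finset.mem_filter, Finset.mem_univ, true_and]
      rintro ⟨i, hi, rfl⟩; exact hQ i hi

lemma choose_half {H m : ℕ} (hH : 1 ≤ H) (hm : (H - 1) / 2 ≤ m) :
    2 ^ H ≤ 4 * ∑ b ∈ Finset.range (m + 1), H.choose b := by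
  obtain ⟨q, hq⟩ : ∃ q, H = 2 * q + 1 ∨ H = 2 * q + 2 := ⟨(H - 1) / 2, by omega⟩
  have hqm : q ≤ m := by omega
  have h1 := Nat.sum_range_choose_halfway q
  have h2 : ∑ i ∈ Finset.range (q + 1), (2 * q + 1).choose i ≤ ∑ i ∈ Finset.range (m + 1), H.choose i := by
    calc _ ≤ ∑ i ∈ Finset.range (q + 1), H.choose i :=
          Finset.sum_le_sum fun i _ => Nat.choose_le_choose i (by omega)
      _ ≤ _ := Finset.sum_le_sum_of_subset (by intro i; simp; omega)
  have h3 : 2 ^ H ≤ 4 * 4 ^ q := by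
    rw [show (4:ℕ) = 2 ^ 2 by norm_num, ← pow_mul, ← pow_add]
    exact Nat.pow_le_pow_right (by norm_num) (by omega)
  omega

lemma choose_mono_half {H b t : ℕ} (hbt : b ≤ t) (ht : 2 * t ≤ H) : H.choose b ≤ H.choose t := by
  induction t, hbt using Nat.le_induction with
  | base => exact le_rfl
  | succ t hbt ih =>
    exact (ih (by omega)).trans (Nat.choose_le_succ_of_lt_half_left (by omega))

lemma choose_tail {H m t : ℕ} (htm : t ≤ m) (hm : 2 * m ≤ H) :
    ∑ b ∈ Finset.range (m + 1), H.choose b ≤ (t + 1) * ∑ b ∈ Finset.Icc t m, H.choose b := by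
  have hsplit : ∑ b ∈ Finset.range (m + 1), H.choose b
      = ∑ b ∈ Finset.range t, H.choose b + ∑ b ∈ Finset.Icc t m, H.choose b := by
    rw [← Finset.sum_range_add_sum_Ico _ (show t ≤ m + 1 by omega)]
    rfl
  have h1 : ∑ b ∈ Finset.range t, H.choose b ≤ t * H.choose t := by
    calc _ ≤ ∑ b ∈ Finset.range t, H.choose t := Finset.sum_le_sum fun b hb =>
            choose_mono_half (Finset.mem_range.1 hb).le (by omega)
      _ = _ := by simp
  have h2 : H.choose t ≤ ∑ b ∈ Finset.Icc t m, H.choose b :=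
    Finset.single_le_sum (f := fun b => H.choose b) (fun _ _ => Nat.zero_le _) (by simp [htm])
  rw [hsplit]
  nlinarith

/-- crossover outcome with zeros in `S` among differing positions -/
def cx {n : ℕ} (u v : BitString n) (S : Finset (Fin n)) : BitString n :=
  fun i => if u i = v i then u i else decide (i ∉ S)

/-- differing positions -/
def dif {n : ℕ} (u v : BitString n) : Finset (Fin n) := Finset.univ.filter fun i => u i ≠ v i

lemma card_dif {n : ℕ} (u v : BitString n) : (dif u v).card = hammingDist u v := by
  simp [dif, hammingDist]

lemma zer_cx {n : ℕ} (u v : BitString n) {S : Finset (Fin n)} (hS : S ⊆ dif u v) :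
    zer (cx u v S) = cz u v + S.card := by
  rw [zer, cz, ← Finset.card_union_of_disjoint]
  · congr 1; ext i
    simp only [Finset.mem_filter, Finset.mem_univ, true_and, Finset.mem_union, cx]
    by_cases h : u i = v i
    · have : i ∉ S := fun hi => by have := hS hi; simp [dif] at this; exact this h
      simp [h, this]
    · simp [h]
  · rw [Finset.disjoint_left]; intro i
    simp only [Finset.mem_filter, Finset.mem_univ, true_and]
    rintro ⟨h, -⟩ hi
    have := hS hi; simp [dif] at this; exact this h

lemma cx_inj {n : ℕ} (u v : BitString n) : Set.InjOn (cx u v) ((dif u v).powerset : Set (Finset (Fin n))) := by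
  intro S hS T hT h
  simp only [Finset.coe_powerset, Set.mem_preimage, Set.mem_powerset_iff, Finset.coe_subset] at hS hT
  ext i
  have hi := congrFun h i
  simp only [cx] at hi
  by_cases huv : u i = v i
  · have h1 : i ∉ S := fun hi => by have := hS hi; simp [dif] at this; exact this huv
    have h2 : i ∉ T := fun hi => by have := hT hi; simp [dif] at this; exact this huv
    simp [h1, h2]
  · simp only [huv, if_false, decide_eq_decide] at hi
    exact not_iff_not.1 hi

lemma pm_cx {n : ℕ} {p : ℝ} (h0 : 0 ≤ p) (h1 : p ≤ 1) (u v : BitString n) (S : Finset (Fin n)) :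
    (1 / 2) ^ hammingDist u v * (1 - p) ^ n ≤ pm p u v (cx u v S) := by
  have := pm_ge h0 h1 u v (cx u v S) 0 (by
    rw [Finset.card_eq_zero, Finset.filter_eq_empty_iff]
    rintro i - ⟨h, h'⟩
    simp [cx, h] at h')
  simpa using this

lemma pr_cx_ge {n : ℕ} {p : ℝ} (h0 : 0 ≤ p) (h1 : p ≤ 1) (u v : BitString n) (B : Finset ℕ)
    {Q : BitString n → Prop} (hQ : ∀ y, (∃ b ∈ B, zer y = cz u v + b) → Q y) {q : ℝ} 
    (hB : q * 2 ^ hammingDist u v ≤ ((∑ b ∈ B, (hammingDist u v).choose b : ℕ) : ℝ)) :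
    q * (1 - p) ^ n ≤ pr p u v Q := by
  have hp : 0 ≤ (1 - p) ^ n := pow_nonneg (by linarith) n
  have hcard : ((dif u v).powerset.filter fun S => S.card ∈ B).card = ∑ b ∈ B, (hammingDist u v).choose b := by
    rw [Finset.card_eq_sum_card_fiberwise (f := Finset.card) (t := B)]
    · refine Finset.sum_congr rfl fun b hb => ?_
      rw [Finset.filter_filter, ← card_dif, ← Finset.card_powersetCard]
      congr 1; ext S
      simp only [Finset.mem_filter, Finset.mem_powerset, Finset.mem_powersetCard]
      constructor
      · rintro ⟨h1, h2, h3⟩; exact ⟨h1, h3⟩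
      · rintro ⟨h1, rfl⟩; exact ⟨h1, hb, rfl⟩
    · intro S hS; simp at hS; exact hS.2
  have := pr_ge h0 h1 u v (Q := Q) ((dif u v).powerset.filter fun S => S.card ∈ B) (cx u v)
    ((cx_inj u v).mono (by intro S hS; simp at hS ⊢; exact hS.1))
    (fun S hS => hQ _ (by
      simp only [Finset.mem_filter, Finset.mem_powerset] at hS
      exact ⟨S.card, hS.2, zer_cx u v hS.1⟩)) (fun S _ => pm_cx h0 h1 u v S)
  refine le_trans ?_ this
  rw [hcard]
  have h2 : q = (q * 2 ^ hammingDist u v) * (1/2) ^ hammingDist u v := by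
    rw [mul_assoc, ← mul_pow]; norm_num
  calc q * (1 - p) ^ n = (q * 2 ^ hammingDist u v) * ((1/2) ^ hammingDist u v * (1 - p) ^ n) := by
        nth_rewrite 1 [h2]; ring
    _ ≤ _ := by gcongr

/-- slope: crossover lands between the plateau and the upper level -/
lemma slope_cross {n k : ℕ} {p : ℝ} (h0 : 0 ≤ p) (h1 : p ≤ 1) (hk : 1 ≤ k) (u v : BitString n) (m : ℕ)
    (hH : 1 ≤ hammingDist u v) (hm1 : (hammingDist u v - 1) / 2 ≤ m) (hm2 : 2 * m ≤ hammingDist u v)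
    (hkm : k ≤ cz u v + m) :
    1 / (8 * k) * (1 - p) ^ n ≤ pr p u v fun y => k ≤ zer y ∧ zer y ≤ cz u v + m := by
  refine pr_cx_ge h0 h1 u v (Finset.Icc (k - cz u v) m) ?_ ?_
  · rintro y ⟨b, hb, e⟩
    rw [Finset.mem_Icc] at hb
    omega
  · have e1 := choose_half hH hm1
    have e2 := choose_tail (show k - cz u v ≤ m by omega) hm2
    have e3 : 2 ^ hammingDist u v ≤ (8 * k) * ∑ b ∈ Finset.Icc (k - cz u v) m, (hammingDist u v).choose b := by
      have : k - cz u v + 1 ≤ 2 * k := by omega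
      calc _ ≤ _ := e1
        _ ≤ 4 * ((k - cz u v + 1) * ∑ b ∈ Finset.Icc (k - cz u v) m, (hammingDist u v).choose b) := by gcongr
        _ ≤ 4 * ((2 * k) * ∑ b ∈ Finset.Icc (k - cz u v) m, (hammingDist u v).choose b) := by gcongr
        _ = _ := by ring
    have hk' : (0:ℝ) < 8 * k := by positivity
    rw [one_div, inv_mul_le_iff₀ hk']
    exact_mod_cast e3

lemma pm_self_flip {n : ℕ} {p : ℝ} (h0 : 0 ≤ p) (h1 : p ≤ 1) (u : BitString n) (i : Fin n) :
    p * (1 - p) ^ n ≤ pm p u u (Function.update u i (!u i)) := by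
  have := pm_ge h0 h1 u u (Function.update u i (!u i)) 1 (by
    rw [Finset.card_eq_one]
    refine ⟨i, ?_⟩
    ext j
    by_cases h : j = i
    · subst h; simp
    · simp [h])
  simpa using this

lemma flip_inj {n : ℕ} (u : BitString n) : Function.Injective fun i => Function.update u i (!u i) := by
  intro i j h
  by_contra hij
  have := congrFun h i
  simp [hij] at this

lemma zer_flip0 {n : ℕ} (u : BitString n) (i : Fin n) (h : u i = false) :
    zer (Function.update u i (!u i)) + 1 = zer u := by
  have : (Finset.univ.filter fun j => u j = false)
      = insert i (Finset.univ.filter fun j => Function.update u i (!u i) j = false) := by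
    ext j
    by_cases hj : j = i
    · subst hj; simp [h]
    · simp [hj]
  rw [zer, zer, this, Finset.card_insert_of_notMem]
  simp [h]

lemma zer_flip1 {n : ℕ} (u : BitString n) (i : Fin n) (h : u i = true) :
    zer (Function.update u i (!u i)) = zer u + 1 := by
  have : (Finset.univ.filter fun j => Function.update u i (!u i) j = false)
      = insert i (Finset.univ.filter fun j => u j = false) := by
    ext j
    by_cases hj : j = i
    · subst hj; simp [h]
    · simp [hj]
  rw [zer, zer, this, Finset.card_insert_of_notMem]
  simp [h]

lemma pr_self {n : ℕ} {p : ℝ} (h0 : 0 ≤ p) (h1 : p ≤ 1) (u : BitString n) {Q : BitString n → Prop}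
    (h : Q u) : (1 - p) ^ n ≤ pr p u u Q := by
  have := pr_ge h0 h1 u u (Q := Q) {()} (fun _ => u) (by simp) (by simpa using h)
    (c := (1 - p) ^ n) (by
      intro _ _
      have := pm_ge h0 h1 u u u 0 (by simp)
      simpa using this)
  simpa using this

lemma slope1 {n k z : ℕ} {p : ℝ} (h0 : 0 ≤ p) (h1 : p ≤ 1) (hk : 1 ≤ k) (u v : BitString n)
    (hu : k ≤ zer u) (hv : k ≤ zer v) (huz : zer u < z) (hvz : zer v ≤ z) :
    1 / (8 * k) * (1 - p) ^ n ≤ pr p u v fun y => k ≤ zer y ∧ zer y < z := by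
  have h2 := two_cz u v
  by_cases hH : hammingDist u v = 0
  · obtain rfl := hammingDist_eq_zero.1 hH
    refine le_trans ?_ (pr_self h0 h1 u ⟨hu, huz⟩)
    have : (1:ℝ) / (8 * k) ≤ 1 := by
      rw [div_le_one (by positivity)]; have : (1:ℝ) ≤ k := by exact_mod_cast hk
      linarith
    have hp : 0 ≤ (1 - p) ^ n := pow_nonneg (by linarith) n
    nlinarith
  · refine (slope_cross h0 h1 hk u v (hammingDist u v / 2) (by omega) (by omega) (by omega) (by omega)).trans
      (pr_mono h0 h1 u v fun y hy => ⟨hy.1, by omega⟩)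

lemma slope2 {n k z : ℕ} {p : ℝ} (h0 : 0 ≤ p) (h1 : p ≤ 1) (hn : (1:ℝ) ≤ n * p) (hk : 1 ≤ k) (hkz : k < z)
    (u v : BitString n)
    (hu : k ≤ zer u) (hv : k ≤ zer v) (huz : zer u ≤ z) (hvz : zer v ≤ z) (hzn : z ≤ n) :
    1 / (8 * k) * (1 - p) ^ n * (z / n) ≤ pr p u v fun y => k ≤ zer y ∧ zer y < z := by
  have h2 := two_cz u v
  have hp : 0 ≤ (1 - p) ^ n := pow_nonneg (by linarith) n
  have hn0 : (0:ℝ) < n := by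
    have : 0 < n := by omega
    exact_mod_cast this
  have hzn' : (z:ℝ) / n ≤ 1 := by rw [div_le_one hn0]; exact_mod_cast hzn
  have h8 : (1:ℝ) / (8 * k) ≤ 1 := by
      rw [div_le_one (by positivity)]; have : (1:ℝ) ≤ k := by exact_mod_cast hk
      linarith
  have hw : 1 / (8 * k) * (1 - p) ^ n * (z / n) ≤ 1 / (8 * k) * (1 - p) ^ n :=
    mul_le_of_le_one_right (by positivity) hzn'
  by_cases huz' : zer u < z
  · exact hw.trans (slope1 h0 h1 hk u v hu hv huz' hvz)
  by_cases hvz' : zer v < z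
  · rw [pr_symm]; exact hw.trans (slope1 h0 h1 hk v u hv hu hvz' huz)
  by_cases hH : hammingDist u v = 0
  · obtain rfl := hammingDist_eq_zero.1 hH
    have hz : zer u = z := by omega
    have := pr_ge h0 h1 u u (Q := fun y => k ≤ zer y ∧ zer y < z) (Finset.univ.filter fun i => u i = false)
      (fun i => Function.update u i (!u i)) (flip_inj u).injOn (by
        intro i hi
        simp only [Finset.mem_filter, Finset.mem_univ, true_and] at hi
        have := zer_flip0 u i hi
        omega) (c := p * (1 - p) ^ n) (fun i _ => pm_self_flip h0 h1 u i)
    refine le_trans ?_ this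
    have e : ((Finset.univ.filter fun i => u i = false).card : ℝ) = z := by exact_mod_cast hz
    rw [e]
    have h3 : (z:ℝ) / n ≤ z * p := by
      rw [div_le_iff₀ hn0]
      have : (0:ℝ) ≤ z := by positivity
      nlinarith
    calc 1 / (8 * k) * (1 - p) ^ n * (z / n) ≤ 1 * (1 - p) ^ n * (z * p) := by gcongr
      _ = _ := by ring
  · refine hw.trans ((slope_cross h0 h1 hk u v ((hammingDist u v - 1) / 2) (by omega) (by omega) (by omega) (by omega)).trans
      (pr_mono h0 h1 u v fun y hy => ⟨hy.1, by omega⟩))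

lemma gap1 {n w : ℕ} {p : ℝ} (h0 : 0 ≤ p) (h1 : p ≤ 1) (hn : (1:ℝ) ≤ n * p) (u v : BitString n)
    (hu : w ≤ zer u) (hv : w ≤ zer v) (hwn : 2 * w ≤ n) :
    1 / 4 * (1 - p) ^ n ≤ pr p u v fun y => w < zer y := by
  have h2 := two_cz u v
  have hp : 0 ≤ (1 - p) ^ n := pow_nonneg (by linarith) n
  by_cases hH : hammingDist u v = 0
  · obtain rfl := hammingDist_eq_zero.1 hH
    by_cases hw : w < zer u
    · refine le_trans ?_ (pr_self h0 h1 u hw)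
      linarith
    · have hz : zer u = w := by omega
      have := pr_ge h0 h1 u u (Q := fun y => w < zer y) (Finset.univ.filter fun i => u i = true)
        (fun i => Function.update u i (!u i)) (flip_inj u).injOn (by
          intro i hi
          simp only [Finset.mem_filter, Finset.mem_univ, true_and] at hi
          have := zer_flip1 u i hi
          omega) (c := p * (1 - p) ^ n) (fun i _ => pm_self_flip h0 h1 u i)
      refine le_trans ?_ this
      have e : n ≤ 2 * (Finset.univ.filter fun i => u i = true).card := by
        have := ones_add_zer u
        rw [onesCount] at this
        omega
      have e' : (n:ℝ) ≤ 2 * ((Finset.univ.filter fun i => u i = true).card : ℝ) := by exact_mod_cast e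
      rw [← mul_assoc]
      refine mul_le_mul_of_nonneg_right ?_ hp
      nlinarith
  · refine pr_cx_ge h0 h1 u v ((Finset.range ((hammingDist u v - 1) / 2 + 1)).image fun b => hammingDist u v - b) ?_ ?_
    · rintro y ⟨b, hb, e⟩
      simp only [Finset.mem_image, Finset.mem_range] at hb
      obtain ⟨b', hb', rfl⟩ := hb
      omega
    · rw [Finset.sum_image (by intro a ha b hb hab; simp at ha hb; simp only at hab; omega)]
      have e1 := choose_half (H := hammingDist u v) (by omega) le_rfl
      have e2 : ∑ b ∈ Finset.range ((hammingDist u v - 1) / 2 + 1), (hammingDist u v).choose (hammingDist u v - b)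
          = ∑ b ∈ Finset.range ((hammingDist u v - 1) / 2 + 1), (hammingDist u v).choose b :=
        Finset.sum_congr rfl fun b hb => Nat.choose_symm (by simp at hb; omega)
      rw [e2]
      have e3 : (2:ℝ) ^ hammingDist u v ≤ 4 * ((∑ b ∈ Finset.range ((hammingDist u v - 1) / 2 + 1), (hammingDist u v).choose b : ℕ) : ℝ) := by exact_mod_cast e1
      linarith

/-! ### Plateau masses -/

lemma pm_opt {n : ℕ} {p : ℝ} (h0 : 0 ≤ p) (h1 : p ≤ 1) (u v : BitString n) :
    (1 / 2) ^ hammingDist u v * p ^ cz u v * (1 - p) ^ n ≤ pm p u v (allOnes n) := by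
  refine pm_ge h0 h1 u v _ _ ?_
  rw [cz]; congr 1; ext i
  simp only [Finset.mem_filter, Finset.mem_univ, true_and, allOnes]
  rcases hu : u i <;> rcases hv : v i <;> simp [hu, hv]

lemma pm_opt' {n k e : ℕ} {p : ℝ} (h0 : 0 < p) (h4 : 4 * p ≤ 1) (u v : BitString n)
    (hu : zer u = k) (hv : zer v = k) (he : 2 * e ≤ hammingDist u v) :
    (1 / 4) ^ e * p ^ (k - e) * (1 - p) ^ n ≤ pm p u v (allOnes n) := by
  refine le_trans ?_ (pm_opt h0.le (by linarith) u v)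
  have h2 := two_cz u v
  refine mul_le_mul_of_nonneg_right ?_ (pow_nonneg (by linarith) n)
  obtain ⟨d, hd⟩ : ∃ d, hammingDist u v = 2 * (e + d) := ⟨hammingDist u v / 2 - e, by omega⟩
  have hc : k - e = cz u v + d := by omega
  rw [hd, hc, pow_mul, pow_add, pow_add]
  have : p ^ d ≤ (1/4 : ℝ) ^ d := pow_le_pow_left₀ h0.le (by linarith) d
  have e4 : ((1:ℝ)/2)^2 = 1/4 := by norm_num
  rw [e4]
  calc (1/4:ℝ) ^ e * (p ^ cz u v * p ^ d) ≤ (1/4) ^ e * (p ^ cz u v * (1/4) ^ d) := by gcongr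
    _ = _ := by ring

/-- near `x` on the plateau -/
def near {n : ℕ} (k : ℕ) (x y : BitString n) : Prop := zer y = k ∧ hammingDist x y = 2

lemma near_cross {n k : ℕ} {p : ℝ} (h0 : 0 ≤ p) (h1 : p ≤ 1) (hkn : k + 1 ≤ n) (x v : BitString n)
    (hx : zer x = k) (hv : near k x v) :
    1 / 4 * (1 + (n - k - 1) * p) * (1 - p) ^ n ≤ pr p x v (near k x) := by
  obtain ⟨hvk, hH⟩ := hv
  have h2 := two_cz x v
  have hl := zer_left x v
  have hr := zer_right x v
  have ha : (Finset.univ.filter fun i => x i = false ∧ v i = true).card = 1 := by omega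
  set T := Finset.univ.filter fun i => x i = true ∧ v i = true with hT
  let e : Fin n → BitString n := fun i => Function.update (fun j => x j || v j) i false
  have hTc : T.card + k + 1 = n := by
    have h3 : onesCount x = T.card + (Finset.univ.filter fun i => x i = true ∧ v i = false).card := by
      rw [onesCount, hT, ← Finset.card_union_of_disjoint]
      · congr 1; ext i
        simp only [Finset.mem_filter, Finset.mem_univ, true_and, Finset.mem_union]
        rcases x i <;> rcases v i <;> simp
      · rw [Finset.disjoint_left]; intro i
        simp only [Finset.mem_filter, Finset.mem_univ, true_and]
        rcases x i <;> rcases v i <;> simp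
    have := ones_add_zer x
    omega
  have hinj : Set.InjOn e T := by
    intro i hi j hj h
    by_contra hij
    have := congrFun h i
    simp only [hT, Finset.coe_filter, Finset.mem_univ, true_and, Set.mem_setOf_eq] at hi
    simp [e, hij, hi] at this
  have hvT : v ∉ T.image e := by
    intro h
    obtain ⟨i, hi, hiv⟩ := Finset.mem_image.1 h
    have : v i = false := by rw [← hiv]; simp [e]
    simp [hT, this] at hi
  have hQ : ∀ i ∈ T, near k x (e i) := by
    intro i hi
    simp only [hT, Finset.mem_filter, Finset.mem_univ, true_and] at hi
    constructor
    · have : (Finset.univ.filter fun j => e i j = false)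
          = insert i (Finset.univ.filter fun j => x j = v j ∧ x j = false) := by
        ext j
        by_cases hj : j = i
        · subst hj; simp [e]
        · simp only [e, Finset.mem_filter, Finset.mem_univ, true_and, Finset.mem_insert, hj, false_or,
            Function.update_of_ne (Ne.symm (Ne.symm hj))]
          rcases x j <;> rcases v j <;> simp
      rw [zer, this, Finset.card_insert_of_notMem (by simp [hi]), ← cz]
      omega
    · have : (Finset.univ.filter fun j => x j ≠ e i j)
          = insert i (Finset.univ.filter fun j => x j = false ∧ v j = true) := by
        ext j
        by_cases hj : j = i
        · subst hj; simp [e, hi]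
        · simp only [e, Finset.mem_filter, Finset.mem_univ, true_and, Finset.mem_insert, hj, false_or,
            Function.update_of_ne (Ne.symm (Ne.symm hj))]
          rcases x j <;> rcases v j <;> simp
      rw [hammingDist, this, Finset.card_insert_of_notMem (by simp [hi]), ha]
  have hm : ∀ i ∈ T, 1 / 4 * p * (1 - p) ^ n ≤ pm p x v (e i) := by
    intro i hi
    simp only [hT, Finset.mem_filter, Finset.mem_univ, true_and] at hi
    have := pm_ge h0 h1 x v (e i) 1 (by
      rw [Finset.card_eq_one]
      refine ⟨i, ?_⟩
      ext j
      by_cases hj : j = i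
      · subst hj; simp [e, hi]
      · simp only [e, Finset.mem_filter, Finset.mem_univ, true_and, Finset.mem_singleton, hj,
            Function.update_of_ne (Ne.symm (Ne.symm hj))]
        rcases x j <;> rcases v j <;> simp)
    rw [hH] at this
    norm_num at this
    linarith
  have hmv : 1 / 4 * (1 - p) ^ n ≤ pm p x v v := by
    have := pm_ge h0 h1 x v v 0 (by
      rw [Finset.card_eq_zero, Finset.filter_eq_empty_iff]
      rintro i - ⟨h, h'⟩
      exact h' h.symm)
    rw [hH] at this
    norm_num at this
    linarith
  have hTr : (T.card : ℝ) = n - k - 1 := by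
    have : ((T.card + k + 1 : ℕ) : ℝ) = n := by exact_mod_cast hTc
    push_cast at this
    linarith
  calc 1 / 4 * (1 + (n - k - 1) * p) * (1 - p) ^ n
      = 1 / 4 * (1 - p) ^ n + ∑ i ∈ T, 1 / 4 * p * (1 - p) ^ n := by
        rw [Finset.sum_const, nsmul_eq_mul, hTr]; ring
    _ ≤ pm p x v v + ∑ i ∈ T, pm p x v (e i) := add_le_add hmv (Finset.sum_le_sum hm)
    _ = ∑ y ∈ insert v (T.image e), pm p x v y := by
        rw [Finset.sum_insert hvT, Finset.sum_image hinj]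
    _ ≤ _ := by
      refine Finset.sum_le_sum_of_subset_of_nonneg ?_ fun y _ _ => pm_nonneg h0 h1 x v y
      intro y
      simp only [Finset.mem_insert, Finset.mem_image, Finset.mem_filter, Finset.mem_univ, true_and]
      rintro (rfl | ⟨i, hi, rfl⟩)
      · exact ⟨hvk, hH⟩
      · exact hQ i hi

lemma near_mut {n k : ℕ} {p : ℝ} (h0 : 0 ≤ p) (h1 : p ≤ 1) (x : BitString n)
    (hx : zer x = k) :
    k * (n - k) * p ^ 2 * (1 - p) ^ n ≤ pr p x x (near k x) := by
  set T := (Finset.univ.filter fun i => x i = false) ×ˢ (Finset.univ.filter fun i => x i = true) with hT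
  let e : Fin n × Fin n → BitString n := fun q => Function.update (Function.update x q.1 true) q.2 false
  have hTc : (T.card : ℝ) = k * (n - k) := by
    have h3 := ones_add_zer x
    rw [hx] at h3
    have h4 : ((onesCount x + k : ℕ) : ℝ) = n := by exact_mod_cast h3
    push_cast at h4
    rw [hT, Finset.card_product, Nat.cast_mul]
    have : (Finset.univ.filter fun i => x i = false).card = k := hx
    rw [this]
    have : (Finset.univ.filter fun i => x i = true).card = onesCount x := rfl
    rw [this]
    rw [← h4]; ring
  have hdiff : ∀ q ∈ T, (Finset.univ.filter fun j => e q j ≠ x j) = {q.1, q.2} ∧ q.1 ≠ q.2 := by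
    rintro ⟨i, j⟩ hq
    simp only [hT, Finset.mem_product, Finset.mem_filter, Finset.mem_univ, true_and] at hq
    have hij : i ≠ j := by rintro rfl; simp [hq.1] at hq
    refine ⟨?_, hij⟩
    ext l
    by_cases hl : l = j
    · subst hl; simp [e, hq]
    · by_cases hl' : l = i
      · subst hl'; simp [e, hl, hq]
      · simp [e, hl, hl']
  have hinj : Set.InjOn e T := by
    rintro ⟨i, j⟩ hq ⟨i', j'⟩ hq' h
    simp only [hT, Finset.coe_product, Finset.coe_filter, Finset.mem_univ, true_and, Set.mem_prod, Set.mem_setOf_eq] at hq hq'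
    have hij : i ≠ j := by rintro rfl; simp [hq.1] at hq
    have hij' : i ≠ j' := by rintro rfl; simp [hq.1] at hq'
    have e1 := congrFun h i
    have e2 := congrFun h j
    have hji' : j ≠ i' := by rintro rfl; simp [hq.2] at hq'
    have a1 : i = i' := by
      by_contra hne
      simp [e, hij, hij', hne, hq.1] at e1
    have a2 : j = j' := by
      by_contra hne
      simp [e, hji', hne, hq.2] at e2
    simp [a1, a2]
  have := pr_ge h0 h1 x x (Q := near k x) T e hinj (by
    rintro q hq
    obtain ⟨hd, hne⟩ := hdiff q hq
    have hh : hammingDist x (e q) = 2 := by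
      rw [hammingDist_comm, hammingDist, hd, Finset.card_pair hne]
    refine ⟨?_, hh⟩
    simp only [hT, Finset.mem_product, Finset.mem_filter, Finset.mem_univ, true_and] at hq
    have hz : zer (e q) = zer (Function.update x q.1 true) + 1 := by
      have := zer_flip1 (Function.update x q.1 true) q.2 (by
        rw [Function.update_of_ne (Ne.symm hne)]; exact hq.2)
      rw [Function.update_of_ne (Ne.symm hne), hq.2] at this
      exact this
    have hz2 := zer_flip0 x q.1 hq.1
    rw [hq.1] at hz2
    simp only [Bool.not_false] at hz2
    omega) (c := p ^ 2 * (1 - p) ^ n) (by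
    intro q hq
    obtain ⟨hd, hne⟩ := hdiff q hq
    have := pm_ge h0 h1 x x (e q) 2 (by
      simp only [true_and]
      rw [hd, Finset.card_pair hne])
    simpa using this)
  rw [hTc] at this
  linarith

lemma marginal {n : ℕ} (p : ℝ) (x : BitString n) (i : Fin n) :
    pr p x x (fun y => y i ≠ x i) = p := by
  have := prod_sum_bool (R := ℝ) (fun (j : Fin n) b =>
    if j = i then (if b = x j then 0 else p) else (if b = x j then 1 - p else p))
  rw [pr, Finset.sum_filter]
  calc _ = ∑ y : BitString n, ∏ j, if j = i then (if y j = x j then 0 else p) else (if y j = x j then 1 - p else p) := by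
        refine Finset.sum_congr rfl fun y _ => ?_
        split_ifs with h
        · rw [pm]
          refine Finset.prod_congr rfl fun j _ => ?_
          by_cases hj : j = i
          · subst hj; simp [h]
          · simp [hj]
        · rw [Finset.prod_eq_zero (Finset.mem_univ i)]
          simp [not_not.1 h]
    _ = _ := by
        rw [this, Finset.prod_eq_single i]
        · rcases x i <;> simp
        · intro j _ hj
          rcases x j <;> simp [hj]
        · simp

lemma plateau_self_le {n k : ℕ} {p : ℝ} (h0 : 0 ≤ p) (h1 : p ≤ 1) (x : BitString n)
    (hx : zer x = k) : pr p x x (fun y => zer y = k) ≤ (1 - p) ^ n + k * p := by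
  have hpt : ∀ y : BitString n, (if zer y = k then pm p x x y else 0) ≤
      (if y = x then pm p x x y else 0) + ∑ i ∈ Finset.univ.filter (fun i => x i = false),
        if y i ≠ x i then pm p x x y else 0 := by
    intro y
    have hnn := pm_nonneg h0 h1 x x y
    have hsn : 0 ≤ ∑ i ∈ Finset.univ.filter (fun i => x i = false),
        if y i ≠ x i then pm p x x y else 0 :=
      Finset.sum_nonneg fun i _ => by split_ifs <;> simp [hnn]
    by_cases hy : zer y = k
    swap
    · rw [if_neg hy]
      have : 0 ≤ (if y = x then pm p x x y else 0) := by split_ifs <;> simp [hnn]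
      linarith
    by_cases hne : y = x
    · rw [if_pos hy, if_pos hne]; linarith
    rw [if_pos hy, if_neg hne, zero_add]
    have hex : ∃ i, x i = false ∧ y i ≠ x i := by
      by_contra hcon
      push Not at hcon
      have hss : (Finset.univ.filter fun i => x i = false) ⊆ (Finset.univ.filter fun i => y i = false) := by
        intro i hi
        simp only [Finset.mem_filter, Finset.mem_univ, true_and] at hi ⊢
        rw [hcon i hi, hi]
      have heq := Finset.eq_of_subset_of_card_le hss (by
        have h1 : (Finset.univ.filter fun i => x i = false).card = k := hx
        have h2 : (Finset.univ.filter fun i => y i = false).card = k := hy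
        omega)
      apply hne
      funext i
      have := Finset.ext_iff.1 heq i
      simp only [Finset.mem_filter, Finset.mem_univ, true_and] at this
      rcases hxi : x i <;> rcases hyi : y i <;> simp [hxi, hyi] at this ⊢
    obtain ⟨i, hi, hyi⟩ := hex
    have h := Finset.single_le_sum (f := fun i => if y i ≠ x i then pm p x x y else 0)
      (s := Finset.univ.filter (fun i => x i = false))
      (fun i _ => by split_ifs <;> simp [hnn]) (by simp [hi] : i ∈ _)
    simpa [hyi] using h
  have hpx : pm p x x x = (1 - p) ^ n := by simp [pm]
  have hs := Finset.sum_le_sum fun y (_ : y ∈ (Finset.univ : Finset (BitString n))) => hpt y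
  rw [Finset.sum_add_distrib, Finset.sum_ite_eq', if_pos (Finset.mem_univ _), hpx, Finset.sum_comm] at hs
  have hm : ∀ i, (∑ y : BitString n, if y i ≠ x i then pm p x x y else 0) = p := by
    intro i
    rw [← Finset.sum_filter]
    have := marginal p x i
    rw [pr] at this
    convert this
  simp only [hm] at hs
  rw [Finset.sum_const, nsmul_eq_mul] at hs
  have hc : (Finset.univ.filter fun i => x i = false).card = k := hx
  rw [hc] at hs
  rw [pr, Finset.sum_filter]
  refine le_trans (le_of_eq (Finset.sum_congr rfl fun y _ => ?_)) hs
  by_cases h : zer y = k <;> simp [h]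

/-! ### Phase 1 -/

/-- probability that the offspring satisfies `Q` -/
def qo {n μ : ℕ} (p : ℝ) (P : Fin μ → BitString n) (Q : BitString n → Prop) : ℝ :=
  ∑ y, off p P y * if Q y then 1 else 0

lemma qo_eq {n μ : ℕ} (p : ℝ) (P : Fin μ → BitString n) (Q : BitString n → Prop) :
    qo p P Q = ∑ i₁, ∑ i₂, ((μ : ℝ)⁻¹ * (μ : ℝ)⁻¹) * pr p (P i₁) (P i₂) Q := by
  rw [qo, off_sum_mul]
  simp only [pr, Finset.sum_filter, mul_ite, mul_one, mul_zero]

lemma qo_ge {n μ : ℕ} (p : ℝ) (P : Fin μ → BitString n) (Q : BitString n → Prop)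
    (f : Fin μ → Fin μ → ℝ) (h : ∀ i j, f i j ≤ pr p (P i) (P j) Q) :
    ((μ : ℝ)⁻¹ * (μ : ℝ)⁻¹) * ∑ i, ∑ j, f i j ≤ qo p P Q := by
  rw [qo_eq, Finset.mul_sum]
  refine Finset.sum_le_sum fun i _ => ?_
  rw [Finset.mul_sum]
  refine Finset.sum_le_sum fun j _ => ?_
  exact mul_le_mul_of_nonneg_left (h i j) (by positivity)

lemma qo_le {n μ : ℕ} (p : ℝ) (P : Fin μ → BitString n) (Q : BitString n → Prop)
    (f : Fin μ → Fin μ → ℝ) (h : ∀ i j, pr p (P i) (P j) Q ≤ f i j) :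
    qo p P Q ≤ ((μ : ℝ)⁻¹ * (μ : ℝ)⁻¹) * ∑ i, ∑ j, f i j := by
  rw [qo_eq, Finset.mul_sum]
  refine Finset.sum_le_sum fun i _ => ?_
  rw [Finset.mul_sum]
  refine Finset.sum_le_sum fun j _ => ?_
  exact mul_le_mul_of_nonneg_left (h i j) (by positivity)

lemma qo_nonneg {n μ : ℕ} {p : ℝ} (h0 : 0 ≤ p) (h1 : p ≤ 1) (P : Fin μ → BitString n) (Q) :
    0 ≤ qo p P Q :=
  Finset.sum_nonneg fun y _ => mul_nonneg (off_nonneg h0 h1 P y) (by split_ifs <;> norm_num)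

lemma qo_le_one {n μ : ℕ} {p : ℝ} (hμ : 1 ≤ μ) (h0 : 0 ≤ p) (h1 : p ≤ 1) (P : Fin μ → BitString n) (Q) :
    qo p P Q ≤ 1 := by
  rw [← off_sum hμ p P]
  refine Finset.sum_le_sum fun y _ => ?_
  have := off_nonneg h0 h1 P y
  split_ifs <;> simp [this]

lemma sum_cnt {n μ : ℕ} (Q : BitString n → Prop) [DecidablePred Q] (P : Fin μ → BitString n) (c : ℝ) :
    ∑ i, (if Q (P i) then c else 0) = cnt Q P * c := by
  rw [← Finset.sum_filter, Finset.sum_const, nsmul_eq_mul, cnt]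
  congr!

lemma cnt_le {n μ : ℕ} (Q : BitString n → Prop) (P : Fin μ → BitString n) : cnt Q P ≤ μ := by
  have := Finset.card_filter_le (Finset.univ : Finset (Fin μ)) fun i => Q (P i)
  simpa [cnt] using this

lemma cnt_add_not {n μ : ℕ} (Q : BitString n → Prop) (P : Fin μ → BitString n) :
    cnt Q P + cnt (fun y => ¬ Q y) P = μ := by
  have := Finset.card_filter_add_card_filter_not (s := (Finset.univ : Finset (Fin μ))) (fun i => Q (P i))
  simpa [cnt] using this

lemma jump_ge {n k : ℕ} (x : BitString n) (h : k ≤ zer x) (hk : k ≤ n) :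
    jump n k x = k + (n - zer x) := by
  have := ones_add_zer x
  rw [jump, if_pos (Or.inr (by omega))]; omega

lemma jump_gap {n k : ℕ} (x : BitString n) (h : zer x < k) (h' : x ≠ allOnes n) (hk : k ≤ n) :
    jump n k x = zer x := by
  have := ones_add_zer x
  have h0 : zer x ≠ 0 := fun h => h' ((zer_eq_zero x).1 h)
  rw [jump, if_neg (by omega)]; omega

lemma jump_opt {n k : ℕ} : jump n k (allOnes n) = k + n := by
  have h := (zer_eq_zero (allOnes n)).2 rfl
  have := ones_add_zer (allOnes n)
  rw [jump, if_pos (Or.inl (by omega))]; omega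

lemma jump_le_n {n k : ℕ} (x : BitString n) (h' : x ≠ allOnes n) (hk : k ≤ n) : jump n k x ≤ n := by
  by_cases h : k ≤ zer x
  · rw [jump_ge x h hk]; omega
  · rw [jump_gap x (by omega) h' hk]; omega

lemma jump_eq_n {n k : ℕ} (x : BitString n) (h' : x ≠ allOnes n) (hk : k < n) :
    jump n k x = n ↔ zer x = k := by
  have := zer_le x
  by_cases h : k ≤ zer x
  · rw [jump_ge x h hk.le]; omega
  · rw [jump_gap x (by omega) h' hk.le]; omega

lemma up_prob {n k μ w : ℕ} {p : ℝ} (h0 : 0 ≤ p) (h1 : p ≤ 1) (hn : (1:ℝ) ≤ n * p) (hk : 1 ≤ k)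
    (hkn : 2 * k ≤ n) (hμ : 1 ≤ μ) (P : Fin μ → BitString n) (hv : ∀ i, P i ≠ allOnes n)
    (hw : w < n) (hmin : ∀ i, w ≤ jump n k (P i)) :
    1 / (8 * k) * (1 - p) ^ n * ((cnt (fun y => w < jump n k y) P) / μ) ≤ qo p P (fun y => w < jump n k y) ∧
    1 / (8 * k) * (1 - p) ^ n * ((n + k - w : ℕ) / n) ≤ qo p P (fun y => w < jump n k y) := by
  have ha : 0 ≤ (1 - p) ^ n := pow_nonneg (by linarith) n
  have hμ' : (0:ℝ) < μ := by exact_mod_cast hμ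
  have hn' : (0:ℝ) < n := by exact_mod_cast (by omega : 0 < n)
  have hk' : (1:ℝ) ≤ k := by exact_mod_cast hk
  by_cases hwk : w < k
  · have hg : 1 / 4 * (1 - p) ^ n ≤ qo p P (fun y => w < jump n k y) := by
      have := qo_ge p P (fun y => w < jump n k y) (fun _ _ => 1 / 4 * (1 - p) ^ n) (by
        intro i j
        have hz : ∀ i, w ≤ zer (P i) := by
          intro i
          have := hmin i
          by_cases h : k ≤ zer (P i)
          · omega
          · rwa [jump_gap _ (by omega) (hv i) (by omega)] at this
        refine (gap1 h0 h1 hn _ _ (hz i) (hz j) (by omega)).trans ?_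
        refine pr_mono h0 h1 _ _ fun y hy => ?_
        by_cases hy1 : y = allOnes n
        · rw [hy1, jump_opt]; omega
        by_cases h : k ≤ zer y
        · rw [jump_ge y h (by omega)]; omega
        · rwa [jump_gap y (by omega) hy1 (by omega)])
      refine le_trans (le_of_eq ?_) this
      simp only [Finset.sum_const, Finset.card_univ, Fintype.card_fin, nsmul_eq_mul]
      field_simp
    have key : ∀ t : ℝ, t ≤ 2 → 1 / (8 * k) * (1 - p) ^ n * t ≤ 1 / 4 * (1 - p) ^ n := by
      intro t ht
      have : 1 / (8 * (k:ℝ)) * t ≤ 1 / 4 := by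
        rw [div_mul_eq_mul_div, div_le_div_iff₀ (by positivity) (by norm_num)]
        nlinarith
      nlinarith
    constructor
    · refine (key _ ?_).trans hg
      rw [div_le_iff₀ hμ']
      have : (cnt (fun y => w < jump n k y) P : ℝ) ≤ μ := by exact_mod_cast cnt_le _ _
      linarith
    · refine (key _ ?_).trans hg
      rw [div_le_iff₀ hn']
      have : ((n + k - w : ℕ) : ℝ) ≤ (2 * n : ℕ) := by exact_mod_cast (by omega)
      push_cast at this; linarith
  · have hz : ∀ i, k ≤ zer (P i) := by
      intro i
      by_contra h
      have := hmin i
      rw [jump_gap _ (by omega) (hv i) (by omega)] at this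
      omega
    have hz2 : ∀ i, zer (P i) ≤ n + k - w := by
      intro i
      have := hmin i
      rw [jump_ge _ (hz i) (by omega)] at this
      have := zer_le (P i)
      omega
    have hsub : ∀ y : BitString n, k ≤ zer y ∧ zer y < n + k - w → w < jump n k y := by
      rintro y ⟨h, h2⟩
      rw [jump_ge y h (by omega)]; omega
    constructor
    · have := qo_ge p P (fun y => w < jump n k y)
        (fun i _ => if w < jump n k (P i) then 1 / (8 * k) * (1 - p) ^ n else 0) (by
        intro i j
        split_ifs with h
        · refine le_trans ?_ (pr_mono h0 h1 _ _ hsub)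
          refine slope1 h0 h1 hk _ _ (hz i) (hz j) ?_ (hz2 j)
          rw [jump_ge _ (hz i) (by omega)] at h
          have := zer_le (P i)
          omega
        · exact pr_nonneg h0 h1 _ _ _)
      refine le_trans (le_of_eq ?_) this
      simp only [Finset.sum_const, Finset.card_univ, Fintype.card_fin, nsmul_eq_mul]
      rw [← Finset.mul_sum, sum_cnt (fun y => w < jump n k y)]
      field_simp
    · have := qo_ge p P (fun y => w < jump n k y)
        (fun _ _ => 1 / (8 * k) * (1 - p) ^ n * ((n + k - w : ℕ) / n)) (by
        intro i j
        refine le_trans ?_ (pr_mono h0 h1 _ _ hsub)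
        exact slope2 h0 h1 hn hk (by omega) _ _ (hz i) (hz j) (hz2 i) (hz2 j) (by omega))
      refine le_trans (le_of_eq ?_) this
      simp only [Finset.sum_const, Finset.card_univ, Fintype.card_fin, nsmul_eq_mul]
      field_simp

/-- cost of a takeover step -/
def cost (n k μ : ℕ) (a : ℝ) (w i : ℕ) : ℝ :=
  (8 * k / a) * if i = 0 then (n : ℝ) / (n + k - w : ℕ) else √(μ * n / (i * (n + k - w : ℕ)))

lemma cost_nonneg {n k μ : ℕ} {a : ℝ} (ha : 0 < a) (w i : ℕ) : 0 ≤ cost n k μ a w i := by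
  unfold cost
  split_ifs <;> positivity

lemma cost_mul {n k μ w i : ℕ} {a q : ℝ} (ha : 0 < a) (hk : 1 ≤ k) (hw : w < n) (hμ : 1 ≤ μ)
    (hq1 : 1 / (8 * k) * a * (i / μ) ≤ q) (hq2 : 1 / (8 * k) * a * ((n + k - w : ℕ) / n) ≤ q) :
    1 ≤ cost n k μ a w i * q := by
  rw [cost]
  have hz : (0:ℝ) < (n + k - w : ℕ) := by exact_mod_cast (by omega)
  generalize ((n + k - w : ℕ) : ℝ) = z at hz hq2 ⊢
  have hμ' : (0:ℝ) < μ := by exact_mod_cast hμ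
  have hn' : (0:ℝ) < n := by exact_mod_cast (by omega : 0 < n)
  have hk' : (0:ℝ) < k := by exact_mod_cast hk
  split_ifs with hi
  · calc (1:ℝ) = 8 * k / a * (n / z) * (1 / (8 * k) * a * (z / n)) := by field_simp
      _ ≤ _ := mul_le_mul_of_nonneg_left hq2 (by positivity)
  · have hi' : (0:ℝ) < i := by exact_mod_cast Nat.pos_of_ne_zero hi
    have hq0 : 0 ≤ q := le_trans (by positivity) hq1
    have hqq : (1 / (8 * k) * a) ^ 2 * ((i * z) / (μ * n)) ≤ q ^ 2 := by
      have := mul_le_mul hq1 hq2 (by positivity) hq0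
      refine le_trans (le_of_eq ?_) (this.trans (le_of_eq (by ring)))
      field_simp
    have h2 : 1 ≤ (8 * k / a * √(μ * n / (i * z)) * q) ^ 2 := by
      rw [mul_pow, mul_pow, Real.sq_sqrt (by positivity)]
      calc (1:ℝ) = (8 * k / a) ^ 2 * (μ * n / (i * z)) * ((1 / (8 * k) * a) ^ 2 * ((i * z) / (μ * n))) := by
            field_simp
        _ ≤ _ := mul_le_mul_of_nonneg_left hqq (by positivity)
    have h3 : 0 ≤ 8 * k / a * √(μ * n / (i * z)) * q := by positivity
    nlinarith

/-- potential of phase 1 -/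
def WW {n μ : ℕ} (k : ℕ) (a : ℝ) (P : Fin μ → BitString n) : ℝ :=
  ∑ w ∈ Finset.range n, ∑ m ∈ Finset.range (cnt (fun y => jump n k y ≤ w) P), cost n k μ a w (μ - 1 - m)

lemma mem_worst {n μ k : ℕ} {P : Fin μ → BitString n} {y : BitString n} {j : Fin (μ + 1)}
    (hj : j ∈ worst k P y) : (∀ i, jump n k ((Fin.snoc P y : Fin (μ + 1) → BitString n) j) ≤ jump n k (P i)) ∧
      jump n k ((Fin.snoc P y : Fin (μ + 1) → BitString n) j) ≤ jump n k y := by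
  simp only [worst, Finset.mem_filter, Finset.mem_univ, true_and] at hj
  refine ⟨fun i => ?_, ?_⟩
  · have := hj i.castSucc
    simpa using this
  · have := hj (Fin.last μ)
    simpa using this

lemma cnt_pos {n μ : ℕ} {Q : BitString n → Prop} {P : Fin μ → BitString n} (i : Fin μ) (h : Q (P i)) :
    1 ≤ cnt Q P := by
  rw [cnt, Nat.one_le_iff_ne_zero, Finset.card_ne_zero]
  exact ⟨i, by simp [h]⟩

lemma N_worst {n μ k w : ℕ} {P : Fin μ → BitString n} {y : BitString n} {j : Fin (μ + 1)}
    (hj : j ∈ worst k P y) :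
    cnt (fun y => jump n k y ≤ w) (removeAt P y j) ≤ cnt (fun y => jump n k y ≤ w) P ∧
    (w < jump n k y → (∃ i, jump n k (P i) ≤ w) →
      cnt (fun y => jump n k y ≤ w) (removeAt P y j) + 1 = cnt (fun y => jump n k y ≤ w) P) := by
  have h := cnt_removeAt (fun y => jump n k y ≤ w) P y j
  obtain ⟨h1, h2⟩ := mem_worst hj
  constructor
  · by_cases hy : jump n k y ≤ w
    · rw [if_pos hy, if_pos (h2.trans hy)] at h; omega
    · rw [if_neg hy] at h; omega
  · rintro hy ⟨i, hi⟩
    rw [if_neg (c := jump n k y ≤ w) (not_le.2 hy), if_pos ((h1 i).trans hi)] at h; omega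

lemma WW_mono {n μ k : ℕ} {a : ℝ} (ha : 0 < a) {P : Fin μ → BitString n} {y : BitString n}
    {j : Fin (μ + 1)} (hj : j ∈ worst k P y) : WW k a (removeAt P y j) ≤ WW k a P := by
  refine Finset.sum_le_sum fun w _ => ?_
  refine Finset.sum_le_sum_of_subset_of_nonneg ?_ fun m _ _ => cost_nonneg ha _ _
  exact Finset.range_mono (N_worst hj).1

lemma WW_step {n μ k w : ℕ} {a : ℝ} (ha : 0 < a) {P : Fin μ → BitString n} {y : BitString n}
    {j : Fin (μ + 1)} (hj : j ∈ worst k P y) (hw : w < n) (hy : w < jump n k y) (hi : ∃ i, jump n k (P i) ≤ w) :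
    WW k a (removeAt P y j) ≤ WW k a P - cost n k μ a w (cnt (fun y => w < jump n k y) P) := by
  have hN := (N_worst (w := w) hj).2 hy hi
  have hc := cnt_add_not (fun y => jump n k y ≤ w) P
  simp only [not_le] at hc
  rw [WW, WW, ← Finset.add_sum_erase _ _ (Finset.mem_range.2 hw),
    ← Finset.add_sum_erase (Finset.range n) _ (Finset.mem_range.2 hw), ← hN, Finset.sum_range_succ]
  have h1 : μ - 1 - cnt (fun y => jump n k y ≤ w) (removeAt P y j) = cnt (fun y => w < jump n k y) P := by
    omega
  rw [h1]
  have : ∑ w ∈ (Finset.range n).erase w, ∑ m ∈ Finset.range (cnt (fun y => jump n k y ≤ w) (removeAt P y j)),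
      cost n k μ a w (μ - 1 - m) ≤ ∑ w ∈ (Finset.range n).erase w, ∑ m ∈ Finset.range (cnt (fun y => jump n k y ≤ w) P),
      cost n k μ a w (μ - 1 - m) := by
    refine Finset.sum_le_sum fun w _ => ?_
    refine Finset.sum_le_sum_of_subset_of_nonneg ?_ fun m _ _ => cost_nonneg ha _ _
    exact Finset.range_mono (N_worst hj).1
  linarith

lemma WW_nonneg {n μ k : ℕ} {a : ℝ} (ha : 0 < a) (P : Fin μ → BitString n) : 0 ≤ WW k a P :=
  Finset.sum_nonneg fun _ _ => Finset.sum_nonneg fun _ _ => cost_nonneg ha _ _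

/-- drift in phase 1 -/
lemma WW_drift {n k μ : ℕ} {p : ℝ} (h0 : 0 ≤ p) (h1 : p < 1) (hn : (1:ℝ) ≤ n * p) (hk : 1 ≤ k)
    (hkn : 2 * k ≤ n) (hμ : 1 ≤ μ) (P : Fin μ → BitString n) (hv : ∀ i, P i ≠ allOnes n)
    (hpl : ¬ ∀ i, zer (P i) = k) :
    ∑ y, off p P y * avg k P y (fun j => WW k ((1 - p) ^ n) (removeAt P y j)) ≤ WW k ((1 - p) ^ n) P - 1 := by
  have ha : 0 < (1 - p) ^ n := pow_pos (by linarith) n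
  obtain ⟨i₀, -, hi₀⟩ := Finset.exists_min_image Finset.univ (fun i => jump n k (P i)) ⟨⟨0, hμ⟩, Finset.mem_univ _⟩
  set w := jump n k (P i₀) with hw
  have hwn : w < n := by
    push Not at hpl
    obtain ⟨i, hi⟩ := hpl
    have h1 := hi₀ i (Finset.mem_univ _)
    have h2 := jump_le_n (k := k) (P i) (hv i) (by omega)
    have h3 := (jump_eq_n (k := k) (P i) (hv i) (by omega)).not.2 hi
    omega
  obtain ⟨hq1, hq2⟩ := up_prob h0 h1.le hn hk hkn hμ P hv hwn (fun i => hi₀ i (Finset.mem_univ _))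
  have hc := cost_mul ha hk hwn hμ hq1 hq2
  have hb : ∀ y, avg k P y (fun j => WW k ((1 - p) ^ n) (removeAt P y j)) ≤
      WW k ((1 - p) ^ n) P - cost n k μ ((1 - p) ^ n) w (cnt (fun y => w < jump n k y) P) *
        (if w < jump n k y then 1 else 0) := by
    intro y
    refine avg_le fun j hj => ?_
    split_ifs with hy
    · rw [mul_one]; exact WW_step ha hj hwn hy ⟨i₀, le_rfl⟩
    · rw [mul_zero, sub_zero]; exact WW_mono ha hj
  calc _ ≤ ∑ y, off p P y * (WW k ((1 - p) ^ n) P - cost n k μ ((1 - p) ^ n) w (cnt (fun y => w < jump n k y) P) *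
        (if w < jump n k y then 1 else 0)) :=
        Finset.sum_le_sum fun y _ => mul_le_mul_of_nonneg_left (hb y) (off_nonneg h0 h1.le P y)
    _ = WW k ((1 - p) ^ n) P * (∑ y, off p P y) - cost n k μ ((1 - p) ^ n) w (cnt (fun y => w < jump n k y) P) *
        qo p P (fun y => w < jump n k y) := by
        rw [qo, Finset.mul_sum, Finset.mul_sum, ← Finset.sum_sub_distrib]
        refine Finset.sum_congr rfl fun y _ => ?_
        by_cases h : w < jump n k y <;> simp [h] <;> ring
    _ ≤ _ := by rw [off_sum hμ]; linarith

lemma sum_inv_sqrt (m : ℕ) : ∑ i ∈ Finset.range m, 1 / √((i:ℝ) + 1) ≤ 2 * √m := by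
  induction m with
  | zero => simp
  | succ m ih =>
    rw [Finset.sum_range_succ]
    have h1 : 0 < √((m:ℝ) + 1) := Real.sqrt_pos.2 (by positivity)
    have h2 : √((m:ℝ) + 1) ^ 2 = m + 1 := Real.sq_sqrt (by positivity)
    have h3 : √(m:ℝ) ^ 2 = m := Real.sq_sqrt (by positivity)
    have h4 : 0 ≤ √(m:ℝ) := Real.sqrt_nonneg _
    have : 1 / √((m:ℝ) + 1) ≤ 2 * √((m:ℝ) + 1) - 2 * √m := by
      rw [div_le_iff₀ h1]
      nlinarith [sq_nonneg (√((m:ℝ) + 1) - √m)]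
    push_cast
    linarith

lemma WW_max {n k μ : ℕ} {a : ℝ} (ha : 0 < a) (P : Fin μ → BitString n) :
    WW k a P ≤ 8 * k / a * (n ^ 2 + 4 * (n * μ)) := by
  have hrow : ∀ w ∈ Finset.range n, ∑ m ∈ Finset.range (cnt (fun y => jump n k y ≤ w) P), cost n k μ a w (μ - 1 - m)
      ≤ 8 * k / a * (n + (1 / √((n - 1 - w : ℕ) + 1)) * (√n * (2 * μ))) := by
    intro w hw
    rw [Finset.mem_range] at hw
    have hz : ((n - 1 - w : ℕ) : ℝ) + 1 ≤ ((n + k - w : ℕ) : ℝ) := by exact_mod_cast (by omega)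
    have hz0 : (0:ℝ) < ((n - 1 - w : ℕ) : ℝ) + 1 := by positivity
    calc _ ≤ ∑ m ∈ Finset.range μ, cost n k μ a w (μ - 1 - m) :=
          Finset.sum_le_sum_of_subset_of_nonneg (Finset.range_mono (cnt_le _ _)) fun m _ _ => cost_nonneg ha _ _
      _ = ∑ m ∈ Finset.range μ, cost n k μ a w m := Finset.sum_range_reflect _ _
      _ ≤ ∑ m ∈ Finset.range (μ + 1), cost n k μ a w m :=
          Finset.sum_le_sum_of_subset_of_nonneg (Finset.range_mono (by omega)) fun m _ _ => cost_nonneg ha _ _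
      _ = 8 * k / a * ((∑ i ∈ Finset.range μ, √(μ * n / ((i + 1) * (n + k - w : ℕ)))) + (n : ℝ) / (n + k - w : ℕ)) := by
          rw [Finset.sum_range_succ', mul_add, Finset.mul_sum]
          simp [cost]
      _ ≤ 8 * k / a * ((∑ i ∈ Finset.range μ, (1 / √((n - 1 - w : ℕ) + 1)) * (√n * √μ) * (1 / √((i:ℝ) + 1))) + n) := by
          gcongr with i hi
          · rw [← Real.sqrt_mul (by positivity), ← Real.sqrt_one, ← Real.sqrt_div (by positivity), ← Real.sqrt_div (by positivity),
              ← Real.sqrt_mul (by positivity), ← Real.sqrt_mul (by positivity)]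
            apply Real.sqrt_le_sqrt
            rw [Real.sqrt_one]
            calc (μ * n / ((i + 1) * (n + k - w : ℕ)) : ℝ) ≤ μ * n / ((i + 1) * ((n - 1 - w : ℕ) + 1)) := by gcongr
              _ = _ := by field_simp
          · apply div_le_self (by positivity)
            have : (0:ℝ) ≤ (n - 1 - w : ℕ) := by positivity
            linarith
      _ ≤ _ := by
          rw [← Finset.mul_sum, add_comm (n:ℝ)]
          refine mul_le_mul_of_nonneg_left (add_le_add ?_ le_rfl) (by positivity)
          calc _ ≤ 1 / √((n - 1 - w : ℕ) + 1) * (√n * √μ) * (2 * √μ) := by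
                gcongr; exact sum_inv_sqrt μ
            _ = 1 / √((n - 1 - w : ℕ) + 1) * (√n * (2 * (√μ * √μ))) := by ring
            _ = _ := by rw [Real.mul_self_sqrt (by positivity)]
  refine (Finset.sum_le_sum hrow).trans ?_
  rw [← Finset.mul_sum, Finset.sum_add_distrib, ← Finset.sum_mul,
    Finset.sum_range_reflect (fun i => 1 / √((i:ℝ) + 1)) n]
  refine mul_le_mul_of_nonneg_left (add_le_add ?_ ?_) (by positivity)
  · simp [sq]
  · calc _ ≤ (2 * √n) * (√n * (2 * μ)) := by gcongr; exact sum_inv_sqrt n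
      _ = 4 * ((√n * √n) * μ) := by ring
      _ = _ := by rw [Real.mul_self_sqrt (by positivity)]

/-! ### Phase 2: potential and its drift -/

/-- soft indicator of a majority -/
def phi (μ Y : ℕ) : ℝ := max 0 (min 1 (4 * (Y : ℝ) / μ - 2))

lemma phi_nonneg (μ Y : ℕ) : 0 ≤ phi μ Y := le_max_left _ _
lemma phi_le_one (μ Y : ℕ) : phi μ Y ≤ 1 := max_le zero_le_one (min_le_left _ _)

lemma phi_zero {μ Y : ℕ} (hμ : 1 ≤ μ) (h : 2 * Y ≤ μ) : phi μ Y = 0 := by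
  have hμ' : (0:ℝ) < μ := by exact_mod_cast hμ
  have h' : 2 * (Y:ℝ) ≤ μ := by exact_mod_cast h
  have : 4 * (Y:ℝ) / μ ≤ 2 := by rw [div_le_iff₀ hμ']; linarith
  exact max_eq_left ((min_le_right _ _).trans (by linarith))

lemma phi_one {μ Y : ℕ} (hμ : 1 ≤ μ) (h : 3 * μ ≤ 4 * Y) : phi μ Y = 1 := by
  have hμ' : (0:ℝ) < μ := by exact_mod_cast hμ
  have h' : 3 * (μ:ℝ) ≤ 4 * Y := by exact_mod_cast h
  have : 3 ≤ 4 * (Y:ℝ) / μ := by rw [le_div_iff₀ hμ']; linarith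
  rw [phi, min_eq_left (by linarith)]; simp

lemma phi_step {μ Y Y' : ℕ} (hμ : 1 ≤ μ) (h : Y' ≤ Y + 1) : phi μ Y' - phi μ Y ≤ 4 / μ := by
  have hμ' : (0:ℝ) < μ := by exact_mod_cast hμ
  have h' : (Y':ℝ) ≤ Y + 1 := by exact_mod_cast h
  have h4 : (0:ℝ) < 4 / μ := by positivity
  have : 4 * (Y':ℝ) / μ - 2 ≤ (4 * (Y:ℝ) / μ - 2) + 4 / μ := by
    have : 4 * (Y':ℝ) / μ ≤ 4 * (Y + 1) / μ := by gcongr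
    have e : 4 * ((Y:ℝ) + 1) / μ = 4 * Y / μ + 4 / μ := by ring
    linarith
  rw [sub_le_iff_le_add]
  unfold phi
  refine max_le ?_ ?_
  · have := le_max_left 0 (min 1 (4 * (Y:ℝ) / μ - 2)); linarith
  · rcases le_total 1 (4 * (Y:ℝ) / μ - 2) with h1 | h1
    · rw [min_eq_left h1]
      have := min_le_left 1 (4 * (Y':ℝ) / μ - 2)
      have := le_max_right 0 (1:ℝ)
      linarith
    · rw [min_eq_right h1]
      have := min_le_right 1 (4 * (Y':ℝ) / μ - 2)
      have := le_max_right 0 (4 * (Y:ℝ) / μ - 2)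
      linarith

/-- remaining cost of increasing diversity -/
def gg (D : ℕ → ℝ) (J j : ℕ) : ℝ := ∑ i ∈ Finset.Ico j J, D i

lemma gg_nonneg {D : ℕ → ℝ} (hD : ∀ i, 0 ≤ D i) (J j : ℕ) : 0 ≤ gg D J j :=
  Finset.sum_nonneg fun i _ => hD i

lemma gg_anti {D : ℕ → ℝ} (hD : ∀ i, 0 ≤ D i) {J j j' : ℕ} (h : j ≤ j') : gg D J j' ≤ gg D J j :=
  Finset.sum_le_sum_of_subset_of_nonneg (Finset.Ico_subset_Ico h le_rfl) fun i _ _ => hD i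

lemma gg_succ {D : ℕ → ℝ} {J j : ℕ} (h : j < J) : gg D J j = D j + gg D J (j + 1) :=
  Finset.sum_eq_sum_Ico_succ_bot h D

lemma gg_zero {D : ℕ → ℝ} {J j : ℕ} (h : J ≤ j) : gg D J j = 0 := by
  rw [gg, Finset.Ico_eq_empty (by omega), Finset.sum_empty]

lemma gg_succ_le {D : ℕ → ℝ} (hD : ∀ i, 0 ≤ D i) {J j : ℕ} : gg D J j ≤ D j + gg D J (j + 1) := by
  rcases lt_or_ge j J with h | h
  · exact (gg_succ h).le
  · rw [gg_zero h]; exact add_nonneg (hD _) (gg_nonneg hD _ _)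

def GX {n μ : ℕ} (k : ℕ) (D : ℕ → ℝ) (J : ℕ) (x : BitString n) (P : Fin μ → BitString n) : ℝ :=
  phi μ (cnt (fun y => y = x) P) * gg D J (cnt (near k x) P)

def GG {n μ : ℕ} (k : ℕ) (D : ℕ → ℝ) (J : ℕ) (P : Fin μ → BitString n) : ℝ := ∑ x, GX k D J x P

lemma GX_nonneg {n μ k : ℕ} {D : ℕ → ℝ} (hD : ∀ i, 0 ≤ D i) (J : ℕ) (x : BitString n) (P : Fin μ → BitString n) :
    0 ≤ GX k D J x P := mul_nonneg (phi_nonneg _ _) (gg_nonneg hD _ _)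

lemma sum_snoc {n μ : ℕ} (P : Fin μ → BitString n) (y : BitString n) (f : BitString n → ℝ) :
    ∑ r, f ((Fin.snoc P y : Fin (μ + 1) → BitString n) r) = ∑ i, f (P i) + f y := by
  rw [Fin.sum_univ_castSucc]; simp

lemma sum_Y {n μ : ℕ} (P : Fin μ → BitString n) : ∑ x, (cnt (fun y => y = x) P : ℝ) = μ := by
  have : ∀ x, (cnt (fun y => y = x) P : ℝ) = ∑ i, if P i = x then 1 else 0 := by
    intro x; rw [cnt_eq]; push_cast; rfl
  simp only [this]
  rw [Finset.sum_comm]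
  simp

/-- contribution of `x` to the drift -/
def DX {n μ : ℕ} (p : ℝ) (k : ℕ) (D : ℕ → ℝ) (J : ℕ) (P : Fin μ → BitString n) (x : BitString n) : ℝ :=
  ∑ y, off p P y * if zer y = k then ((μ : ℝ) + 1)⁻¹ * ∑ r, (GX k D J x (removeAt P y r) - GX k D J x P) else 0

lemma cnt_step {n μ : ℕ} (Q : BitString n → Prop) (P : Fin μ → BitString n) (y : BitString n) (r : Fin (μ + 1)) :
    cnt Q (removeAt P y r) ≤ cnt Q P + 1 ∧ cnt Q P ≤ cnt Q (removeAt P y r) + 1 := by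
  have := cnt_removeAt Q P y r
  split_ifs at this <;> omega

lemma DX_zero {n μ k J : ℕ} (p : ℝ) (D : ℕ → ℝ) (P : Fin μ → BitString n) (x : BitString n)
    (hμ : 6 ≤ μ) (h : 3 * cnt (fun y => y = x) P < μ ∨ J + 1 ≤ cnt (near k x) P) : DX p k D J P x = 0 := by
  refine Finset.sum_eq_zero fun y _ => ?_
  split_ifs
  · rw [Finset.sum_eq_zero, mul_zero, mul_zero]
    intro r _
    rw [GX, GX]
    rcases h with h | h
    · have := (cnt_step (fun y => y = x) P y r).1
      rw [phi_zero (by omega) (by omega), phi_zero (by omega) (by omega)]; ring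
    · have := (cnt_step (near k x) P y r).2
      rw [gg_zero (by omega), gg_zero (by omega)]; ring
  · simp

lemma g_diff {n μ k J : ℕ} {D : ℕ → ℝ} (hD : ∀ i, 0 ≤ D i) (P : Fin μ → BitString n) (x y : BitString n)
    (r : Fin (μ + 1)) : gg D J (cnt (near k x) (removeAt P y r)) - gg D J (cnt (near k x) P) ≤
      if near k x y then 0 else
      if near k x ((Fin.snoc P y : Fin (μ + 1) → BitString n) r) then D (cnt (near k x) P - 1) else 0 := by
  have h := cnt_removeAt (near k x) P y r
  by_cases hy : near k x y
  · rw [if_pos hy] at h ⊢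
    have : cnt (near k x) P ≤ cnt (near k x) (removeAt P y r) := by split_ifs at h <;> omega
    have := gg_anti hD (J := J) this
    linarith
  · rw [if_neg hy] at h ⊢
    by_cases hr : near k x ((Fin.snoc P y : Fin (μ + 1) → BitString n) r)
    · rw [if_pos hr] at h ⊢
      have e : cnt (near k x) (removeAt P y r) = cnt (near k x) P - 1 := by omega
      have e2 : cnt (near k x) P = cnt (near k x) P - 1 + 1 := by omega
      rw [e]
      have := gg_succ_le hD (J := J) (j := cnt (near k x) P - 1)
      rw [← e2] at this
      linarith
    · rw [if_neg hr] at h ⊢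
      rw [show cnt (near k x) (removeAt P y r) = cnt (near k x) P by omega]
      simp

lemma sum_g_diff {n μ k : ℕ} (D : ℕ → ℝ) (P : Fin μ → BitString n) (x y : BitString n) :
    ∑ r, (if near k x y then (0:ℝ) else
      if near k x ((Fin.snoc P y : Fin (μ + 1) → BitString n) r) then D (cnt (near k x) P - 1) else 0)
    = if near k x y then 0 else cnt (near k x) P * D (cnt (near k x) P - 1) := by
  by_cases hy : near k x y
  · simp [hy]
  · simp only [hy, if_false]
    rw [sum_snoc P y (fun z => if near k x z then D (cnt (near k x) P - 1) else 0), sum_cnt (near k x)]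
    simp [hy]

lemma DX_gen {n μ k J : ℕ} {p : ℝ} (h0 : 0 ≤ p) (h1 : p ≤ 1) {D : ℕ → ℝ} (hD : ∀ i, 0 ≤ D i)
    (P : Fin μ → BitString n) (x : BitString n) (hμ : 1 ≤ μ) :
    DX p k D J P x ≤ cnt (near k x) P * D (cnt (near k x) P - 1) / (μ + 1)
      + 4 / μ * gg D J (cnt (near k x) P) := by
  set j := cnt (near k x) P with hj
  have hμ' : (0:ℝ) < μ := by exact_mod_cast hμ
  have hB : 0 ≤ (j:ℝ) * D (j - 1) / (μ + 1) + 4 / μ * gg D J j := by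
    have := hD (j - 1); have := gg_nonneg hD J j; positivity
  have hin : ∀ y, ((μ : ℝ) + 1)⁻¹ * ∑ r, (GX k D J x (removeAt P y r) - GX k D J x P) ≤
      (j:ℝ) * D (j - 1) / (μ + 1) + 4 / μ * gg D J j := by
    intro y
    have hr : ∀ r, GX k D J x (removeAt P y r) - GX k D J x P ≤
        (if near k x y then (0:ℝ) else
          if near k x ((Fin.snoc P y : Fin (μ + 1) → BitString n) r) then D (cnt (near k x) P - 1) else 0)
        + 4 / μ * gg D J j := by
      intro r
      have e1 := g_diff (J := J) (k := k) hD P x y r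
      have e2 := phi_step (Y := cnt (fun y => y = x) P) hμ (cnt_step (fun y => y = x) P y r).1
      have e3 := phi_nonneg μ (cnt (fun y => y = x) (removeAt P y r))
      have e4 := phi_le_one μ (cnt (fun y => y = x) (removeAt P y r))
      have e5 := gg_nonneg hD J j
      have e6 : 0 ≤ (if near k x y then (0:ℝ) else
          if near k x ((Fin.snoc P y : Fin (μ + 1) → BitString n) r) then D (cnt (near k x) P - 1) else 0) := by
        split_ifs
        · exact le_rfl
        · exact hD _
        · exact le_rfl
      rw [GX, GX]
      rw [← hj] at e1 ⊢
      set ph := phi μ (cnt (fun y => y = x) (removeAt P y r))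
      set ph0 := phi μ (cnt (fun y => y = x) P)
      calc ph * gg D J (cnt (near k x) (removeAt P y r)) - ph0 * gg D J j
          = ph * (gg D J (cnt (near k x) (removeAt P y r)) - gg D J j) + (ph - ph0) * gg D J j := by ring
        _ ≤ _ := by
          refine add_le_add ?_ (mul_le_mul_of_nonneg_right e2 e5)
          refine (mul_le_mul_of_nonneg_left e1 e3).trans ?_
          rw [← hj] at e6
          exact mul_le_of_le_one_left e6 e4
    calc _ ≤ ((μ : ℝ) + 1)⁻¹ * ∑ r : Fin (μ + 1), ((if near k x y then (0:ℝ) else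
          if near k x ((Fin.snoc P y : Fin (μ + 1) → BitString n) r) then D (cnt (near k x) P - 1) else 0)
        + 4 / μ * gg D J j) := by
          refine mul_le_mul_of_nonneg_left (Finset.sum_le_sum fun r _ => hr r) (by positivity)
      _ ≤ ((μ : ℝ) + 1)⁻¹ * (j * D (j - 1) + (μ + 1) * (4 / μ * gg D J j)) := by
          rw [Finset.sum_add_distrib, sum_g_diff]
          refine mul_le_mul_of_nonneg_left (add_le_add ?_ ?_) (by positivity)
          · split_ifs
            · exact mul_nonneg (by positivity) (hD _)
            · exact le_rfl
          · simp
      _ = _ := by field_simp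
  calc DX p k D J P x ≤ ∑ y, off p P y * ((j:ℝ) * D (j - 1) / (μ + 1) + 4 / μ * gg D J j) := by
        refine Finset.sum_le_sum fun y _ => mul_le_mul_of_nonneg_left ?_ (off_nonneg h0 h1 P y)
        split_ifs
        · exact hin y
        · exact hB
    _ = _ := by rw [← Finset.sum_mul, off_sum hμ, one_mul]

lemma DX_maj {n μ k J : ℕ} {p : ℝ} (h0 : 0 ≤ p) (h1 : p ≤ 1) {D : ℕ → ℝ} (hD : ∀ i, 0 ≤ D i)
    (P : Fin μ → BitString n) (x : BitString n) (hμ : 1 ≤ μ) (hY : 3 * μ + 4 ≤ 4 * cnt (fun y => y = x) P)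
    (hJ : cnt (near k x) P < J) :
    DX p k D J P x ≤ ((μ:ℝ) + 1)⁻¹ * (cnt (near k x) P * D (cnt (near k x) P - 1) * qo p P (fun y => zer y = k)
      - (μ - cnt (near k x) P) * D (cnt (near k x) P) * qo p P (near k x)) := by
  set j := cnt (near k x) P with hj
  have hin : ∀ y, (if zer y = k then ((μ : ℝ) + 1)⁻¹ * ∑ r, (GX k D J x (removeAt P y r) - GX k D J x P) else 0) ≤
      ((μ:ℝ) + 1)⁻¹ * (j * D (j - 1) * (if zer y = k then 1 else 0) - (μ - j) * D j * (if near k x y then 1 else 0)) := by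
    intro y
    have hGX : ∀ r, GX k D J x (removeAt P y r) - GX k D J x P =
        gg D J (cnt (near k x) (removeAt P y r)) - gg D J j := by
      intro r
      have := (cnt_step (fun y => y = x) P y r).2
      rw [GX, GX, phi_one hμ (by omega), phi_one hμ (by omega)]; ring
    simp only [hGX]
    by_cases hz : zer y = k
    · simp only [hz, if_true, mul_one]
      refine mul_le_mul_of_nonneg_left ?_ (by positivity)
      by_cases hy : near k x y
      · have hr : ∀ r, gg D J (cnt (near k x) (removeAt P y r)) - gg D J j =
            (if near k x ((Fin.snoc P y : Fin (μ + 1) → BitString n) r) then D j else 0) - D j := by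
          intro r
          have h := cnt_removeAt (near k x) P y r
          rw [if_pos hy] at h
          by_cases hr : near k x ((Fin.snoc P y : Fin (μ + 1) → BitString n) r)
          · rw [if_pos hr] at h ⊢
            rw [show cnt (near k x) (removeAt P y r) = j by omega]; ring
          · rw [if_neg hr] at h ⊢
            rw [show cnt (near k x) (removeAt P y r) = j + 1 by omega, gg_succ hJ]; ring
        simp only [hr]
        rw [Finset.sum_sub_distrib, sum_snoc P y (fun z => if near k x z then D j else 0), sum_cnt (near k x),
          if_pos hy, if_pos hy]
        simp only [Finset.sum_const, Finset.card_univ, Fintype.card_fin, nsmul_eq_mul]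
        rw [← hj]
        push_cast
        have : 0 ≤ (j:ℝ) * D (j - 1) := mul_nonneg (by positivity) (hD _)
        nlinarith
      · have := Finset.sum_le_sum fun r (_ : r ∈ Finset.univ) => g_diff (J := J) (k := k) hD P x y r
        rw [sum_g_diff, if_neg hy] at this
        rw [if_neg hy]
        linarith
    · have : ¬ near k x y := fun h => hz h.1
      simp [hz, this]
  calc DX p k D J P x ≤ ∑ y, off p P y * (((μ:ℝ) + 1)⁻¹ * (j * D (j - 1) * (if zer y = k then 1 else 0)
        - (μ - j) * D j * (if near k x y then 1 else 0))) := by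
        refine Finset.sum_le_sum fun y _ => mul_le_mul_of_nonneg_left (hin y) (off_nonneg h0 h1 P y)
    _ = _ := by
        rw [qo, qo, Finset.mul_sum, Finset.mul_sum, ← Finset.sum_sub_distrib, Finset.mul_sum]
        refine Finset.sum_congr rfl fun y _ => ?_
        by_cases h : zer y = k <;> by_cases h' : near k x y <;> simp [h, h'] <;> ring

/-- drift decomposition on the plateau -/
lemma GG_drift {n μ k J : ℕ} {p : ℝ} (D : ℕ → ℝ) (P : Fin μ → BitString n) :
    ∑ y, off p P y * (if zer y = k then ((μ : ℝ) + 1)⁻¹ * ∑ r, (GG k D J (removeAt P y r) - GG k D J P) else 0)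
      = ∑ x, DX p k D J P x := by
  simp only [DX, GG]
  rw [Finset.sum_comm]
  refine Finset.sum_congr rfl fun y _ => ?_
  rw [← Finset.mul_sum]
  congr 1
  split_ifs
  · rw [← Finset.mul_sum, Finset.sum_comm]
    simp only [Finset.sum_sub_distrib]
  · simp

/-! ### Phase 2: probabilities -/

lemma sum_cnt2 {n μ : ℕ} (Q R : BitString n → Prop) (P : Fin μ → BitString n) (c : ℝ) :
    ∑ i, ∑ j, (if Q (P i) ∧ R (P j) then c else 0) = cnt Q P * (cnt R P * c) := by
  rw [← sum_cnt Q P]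
  refine Finset.sum_congr rfl fun i _ => ?_
  by_cases h : Q (P i)
  · simp only [h, true_and, if_true]
    exact sum_cnt R P c
  · simp [h]

lemma qnear_ge {n μ k : ℕ} {p : ℝ} (h0 : 0 ≤ p) (h1 : p ≤ 1) (hkn : k + 1 ≤ n) (P : Fin μ → BitString n)
    (x : BitString n) (hx : zer x = k) :
    ((μ : ℝ)⁻¹ * (μ : ℝ)⁻¹) * (2 * (cnt (fun y => y = x) P * (cnt (near k x) P * (1 / 4 * (1 + (n - k - 1) * p) * (1 - p) ^ n)))
      + cnt (fun y => y = x) P * (cnt (fun y => y = x) P * (k * (n - k) * p ^ 2 * (1 - p) ^ n))) ≤ qo p P (near k x) := by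
  set c1 := 1 / 4 * (1 + (n - k - 1) * p) * (1 - p) ^ n
  set c2 := k * (n - k) * p ^ 2 * (1 - p) ^ n
  have hne : ¬ near k x x := fun h => by simpa using h.2
  have := qo_ge p P (near k x) (fun i j => (if P i = x ∧ near k x (P j) then c1 else 0) +
    (if near k x (P i) ∧ P j = x then c1 else 0) + (if P i = x ∧ P j = x then c2 else 0)) (by
    intro i j
    have hnn := pr_nonneg h0 h1 (P i) (P j) (near k x)
    by_cases hi : P i = x
    · by_cases hj : P j = x
      · simp only [hi, hj, hne, and_false, false_and, if_false, and_self, if_true]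
        have : c2 ≤ _ := near_mut h0 h1 x hx
        linarith
      · by_cases hj' : near k x (P j)
        · simp only [hi, hj, hj', and_self, if_true, and_false, if_false]
          have : c1 ≤ _ := near_cross h0 h1 hkn x (P j) hx hj'
          linarith
        · simp only [hj, hj', and_false, if_false]; linarith
    · by_cases hi' : near k x (P i)
      · by_cases hj : P j = x
        · simp only [hi, hi', hj, false_and, if_false, and_self, if_true]
          have : c1 ≤ _ := near_cross h0 h1 hkn x (P i) hx hi'
          rw [pr_symm] at this
          linarith
        · simp only [hi, hj, and_false, false_and, if_false]; linarith
      · simp only [hi, hi', false_and, if_false]; linarith)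
  refine le_trans (le_of_eq ?_) this
  simp only [Finset.sum_add_distrib]
  have e1 : (∑ i, ∑ j, if P i = x ∧ near k x (P j) then c1 else 0) = (cnt (fun y => y = x) P : ℝ) * ((cnt (near k x) P : ℝ) * c1) := by
    convert sum_cnt2 (fun y => y = x) (near k x) P c1
  have e2 : (∑ i, ∑ j, if near k x (P i) ∧ P j = x then c1 else 0) = (cnt (near k x) P : ℝ) * ((cnt (fun y => y = x) P : ℝ) * c1) := by
    convert sum_cnt2 (near k x) (fun y => y = x) P c1
  have e3 : (∑ i, ∑ j, if P i = x ∧ P j = x then c2 else 0) = (cnt (fun y => y = x) P : ℝ) * ((cnt (fun y => y = x) P : ℝ) * c2) := by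
    convert sum_cnt2 (fun y => y = x) (fun y => y = x) P c2
  rw [e1, e2, e3]
  ring

lemma qplat_le {n μ k : ℕ} {p : ℝ} (h0 : 0 ≤ p) (h1 : p ≤ 1) (hμ : 1 ≤ μ) (P : Fin μ → BitString n)
    (x : BitString n) (hx : zer x = k) :
    qo p P (fun y => zer y = k) ≤ 1 + (cnt (fun y => y = x) P / μ) * (cnt (fun y => y = x) P / μ) * ((1 - p) ^ n + k * p - 1) := by
  have := qo_le p P (fun y => zer y = k) (fun i j => 1 + (if P i = x ∧ P j = x then ((1 - p) ^ n + k * p - 1) else 0)) (by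
    intro i j
    by_cases h : P i = x ∧ P j = x
    · rw [if_pos h, h.1, h.2]
      have := plateau_self_le h0 h1 x hx
      linarith
    · rw [if_neg h, add_zero]; exact pr_le_one h0 h1 _ _ _)
  refine this.trans (le_of_eq ?_)
  simp only [Finset.sum_add_distrib]
  have e3 : (∑ i, ∑ j, if P i = x ∧ P j = x then ((1 - p) ^ n + k * p - 1) else 0) = (cnt (fun y => y = x) P : ℝ) * ((cnt (fun y => y = x) P : ℝ) * ((1 - p) ^ n + k * p - 1)) := by
    convert sum_cnt2 (fun y => y = x) (fun y => y = x) P ((1 - p) ^ n + k * p - 1)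
  rw [e3]
  have hμ' : (0:ℝ) < μ := by exact_mod_cast hμ
  simp only [Finset.sum_const, Finset.card_univ, Fintype.card_fin, nsmul_eq_mul, mul_one]
  field_simp

lemma off_ge {n μ : ℕ} {p c : ℝ} (h0 : 0 ≤ p) (h1 : p ≤ 1) (P : Fin μ → BitString n) (y : BitString n)
    (Q R : BitString n → Prop) (h : ∀ i j, Q (P i) → R (P j) → c ≤ pm p (P i) (P j) y) :
    ((μ : ℝ)⁻¹ * (μ : ℝ)⁻¹) * (cnt Q P * (cnt R P * c)) ≤ off p P y := by
  rw [off, ← sum_cnt2, Finset.mul_sum]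
  refine Finset.sum_le_sum fun i _ => ?_
  rw [Finset.mul_sum]
  refine Finset.sum_le_sum fun j _ => mul_le_mul_of_nonneg_left ?_ (by positivity)
  split_ifs with hc
  · exact h i j hc.1 hc.2
  · exact pm_nonneg h0 h1 _ _ _

/-- step costs of phase 2 -/
def DD (a0 η n μ : ℝ) (i : ℕ) : ℝ :=
  2 / a0 * n * ((1 + η / 16) / (1 + η / 8)) ^ i + (64 * (64 / η) / (a0 * η)) * μ / (i + 64 / η)

lemma DD_nonneg {a0 η n μ : ℝ} (ha : 0 < a0) (hη : 0 < η) (hn : 0 ≤ n) (hμ : 0 ≤ μ) (i : ℕ) : 0 ≤ DD a0 η n μ i := by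
  unfold DD; positivity

lemma DD_step {a0 η n μ : ℝ} (ha : 0 < a0) (hη : 0 < η) (hη1 : η ≤ 1) (hμ : 0 ≤ μ) (i : ℕ) :
    (1 + η / 16) * DD a0 η n μ i - (1 + η / 8) * DD a0 η n μ (i + 1) ≤
      - ((64 * (64 / η) / (a0 * η)) * μ * (η / 32) / ((i + 1 : ℕ) + 64 / η)) := by
  unfold DD
  set B := 64 * (64 / η) / (a0 * η) with hB
  have hB0 : 0 < B := by positivity
  set i0 := 64 / η with hi0
  have hi0p : 0 < i0 := by positivity
  have hi0e : i0 * η = 64 := by rw [hi0]; field_simp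
  rw [pow_succ]
  set R := ((1 + η / 16) / (1 + η / 8)) ^ i
  have e1 : (1 + η / 8) * (2 / a0 * n * (R * ((1 + η / 16) / (1 + η / 8)))) = (1 + η / 16) * (2 / a0 * n * R) := by
    field_simp
  have hx : (0:ℝ) < (i:ℝ) + i0 := by positivity
  have hkey : (1 + η / 16) * (B * μ / (i + i0)) - (1 + η / 8) * (B * μ / (((i + 1 : ℕ):ℝ) + i0)) ≤
      - (B * μ * (η / 32) / ((i + 1 : ℕ) + i0)) := by
    push_cast
    have hx2 : (0:ℝ) < (i:ℝ) + 1 + i0 := by positivity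
    have : (1 + η / 16) / ((i:ℝ) + i0) ≤ (1 + η / 8 - η / 32) / ((i:ℝ) + 1 + i0) := by
      rw [div_le_div_iff₀ hx hx2]
      have : (0:ℝ) ≤ i * η := by positivity
      nlinarith
    have h2 := mul_le_mul_of_nonneg_left this (by positivity : 0 ≤ B * μ)
    have e3 : B * μ * ((1 + η / 8 - η / 32) / ((i:ℝ) + 1 + i0)) =
      (1 + η / 8) * (B * μ / ((i:ℝ) + 1 + i0)) - B * μ * (η / 32) / ((i:ℝ) + 1 + i0) := by ring
    rw [e3] at h2
    have e4 : B * μ * ((1 + η / 16) / ((i:ℝ) + i0)) = (1 + η / 16) * (B * μ / (i + i0)) := by ring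
    linarith
  rw [mul_add, mul_add, e1]
  linarith

lemma maj_real {a a0 η ε n μ q1 q2 : ℝ} {j : ℕ} (ha0 : 0 < a0) (ha : a0 ≤ a) (hη : 0 < η) (hη1 : η ≤ 1)
    (hε : 0 < ε) (hε1 : ε ≤ η / 100) (hn : 0 < n) (hμ : 0 < μ) (hj : (j:ℝ) ≤ ε * μ / 2) (hμε : 2 ≤ ε * μ)
    (hq1 : a * (1 - ε) * (1 + η / 4) * (j / μ) + a / n ≤ q1) (hq2 : q2 ≤ a * (1 + η / 16)) :
    (μ + 1)⁻¹ * (j * DD a0 η n μ (j - 1) * q2 - (μ - j) * DD a0 η n μ j * q1) ≤ -1 := by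
  have hap : 0 < a := by linarith
  have hD := fun i => DD_nonneg ha0 hη hn.le hμ.le i
  have hf : 1 - ε ≤ (μ + 1)⁻¹ * (μ - j) := by
    rw [inv_mul_eq_div, le_div_iff₀ (by positivity)]
    nlinarith
  have he : ε ≤ 1 / 100 := by linarith
  have hq10 : 0 ≤ q1 := le_trans (by
    have : 0 ≤ 1 - ε := by linarith
    positivity) hq1
  rcases Nat.eq_zero_or_pos j with rfl | hjp
  · have hD0 : 2 / a0 * n ≤ DD a0 η n μ 0 := by
      unfold DD; simp only [pow_zero, mul_one]
      have : 0 ≤ 64 * (64 / η) / (a0 * η) * μ / ((0:ℕ) + 64 / η) := by positivity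
      linarith
    simp only [Nat.cast_zero, zero_mul, zero_div, mul_zero, zero_add, sub_zero, zero_sub] at *
    have h1 : 1 / 2 * (2 / a0 * n) * (a / n) ≤ (μ + 1)⁻¹ * μ * DD a0 η n μ 0 * q1 := by
      have hD00 := hD 0
      gcongr; linarith
    have h2 : 1 ≤ 1 / 2 * (2 / a0 * n) * (a / n) := by
      have : 1 / 2 * (2 / a0 * n) * (a / n) = a / a0 := by field_simp
      rw [this, le_div_iff₀ ha0]; linarith
    linarith
  · obtain ⟨i, rfl⟩ : ∃ i, j = i + 1 := ⟨j - 1, by omega⟩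
    simp only [Nat.add_sub_cancel]
    set t : ℝ := ((i + 1 : ℕ) : ℝ) / μ with ht
    have htp : 0 < t := by positivity
    have hjt : (μ + 1)⁻¹ * ((i + 1 : ℕ):ℝ) ≤ t := by
      rw [ht, div_eq_mul_inv, mul_comm]
      gcongr; linarith
    have hlow : a * (1 + η / 8) * t ≤ (1 - ε) * q1 := by
      have h3 : (1 + η / 8) ≤ (1 - ε) * ((1 - ε) * (1 + η / 4)) := by
        have g1 : 1 - η / 50 ≤ (1 - ε) * (1 - ε) := by nlinarith
        have g2 := mul_le_mul_of_nonneg_right g1 (by positivity : 0 ≤ 1 + η / 4)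
        nlinarith
      calc a * (1 + η / 8) * t ≤ a * ((1 - ε) * ((1 - ε) * (1 + η / 4))) * t := by gcongr
        _ = (1 - ε) * (a * (1 - ε) * (1 + η / 4) * t) := by ring
        _ ≤ (1 - ε) * q1 := by
          apply mul_le_mul_of_nonneg_left _ (by linarith)
          have : 0 < a / n := by positivity
          linarith
    have hA : (μ + 1)⁻¹ * ((μ - (i + 1 : ℕ)) * DD a0 η n μ (i + 1) * q1) ≥ DD a0 η n μ (i + 1) * (a * (1 + η / 8) * t) := by
      calc _ = DD a0 η n μ (i + 1) * ((μ + 1)⁻¹ * (μ - (i + 1 : ℕ)) * q1) := by ring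
        _ ≥ DD a0 η n μ (i + 1) * ((1 - ε) * q1) := by
          apply mul_le_mul_of_nonneg_left _ (hD _)
          exact mul_le_mul_of_nonneg_right hf hq10
        _ ≥ _ := mul_le_mul_of_nonneg_left hlow (hD _)
    have hBd : (μ + 1)⁻¹ * (((i + 1 : ℕ):ℝ) * DD a0 η n μ i * q2) ≤ t * DD a0 η n μ i * (a * (1 + η / 16)) := by
      calc (μ + 1)⁻¹ * (((i + 1 : ℕ):ℝ) * DD a0 η n μ i * q2)
          ≤ (μ + 1)⁻¹ * (((i + 1 : ℕ):ℝ) * DD a0 η n μ i * (a * (1 + η / 16))) := by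
            have := hD i
            gcongr
        _ = ((μ + 1)⁻¹ * ((i + 1 : ℕ):ℝ)) * (DD a0 η n μ i * (a * (1 + η / 16))) := by ring
        _ ≤ t * (DD a0 η n μ i * (a * (1 + η / 16))) := by
            have := hD i
            gcongr
        _ = _ := by ring
    have hst := DD_step (n := n) ha0 hη hη1 hμ.le i
    have hst2 := mul_le_mul_of_nonneg_left hst (by positivity : 0 ≤ a * t)
    have hfin : 1 ≤ a * t * ((64 * (64 / η) / (a0 * η)) * μ * (η / 32) / ((i + 1 : ℕ) + 64 / η)) := by
      have hcard : (1:ℝ) ≤ ((i + 1 : ℕ):ℝ) := by push_cast; linarith [(Nat.cast_nonneg i : (0:ℝ) ≤ i)]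
      generalize ((i + 1 : ℕ):ℝ) = c at ht hcard
      have : a * t * ((64 * (64 / η) / (a0 * η)) * μ * (η / 32) / (c + 64 / η)) =
          (a * (c * 128)) / (a0 * (c * η + 64)) := by
        rw [ht]; field_simp; ring
      rw [this, le_div_iff₀ (by positivity)]
      have : c * η ≤ c := by nlinarith
      nlinarith
    rw [mul_sub]
    nlinarith

/-- strong drift when one genotype dominates -/
lemma DX_dom {n μ k J : ℕ} {p a0 η ε : ℝ} (h0 : 0 ≤ p) (h1 : p ≤ 1) (ha0 : 0 < a0) (ha : a0 ≤ (1 - p) ^ n)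
    (hη : 0 < η) (hη1 : η ≤ 1) (hε : 0 < ε) (hεe : ε ≤ a0 * η / 100) (hk : 3 ≤ k) (hkn : 2 * k ≤ n)
    (hnp : 1 ≤ n * p) (hnk : 1 + η / 2 ≤ (n - k - 1) * p) (hkp : k * p ≤ a0 * η / 32)
    (hμ8 : 8 ≤ ε * μ) (P : Fin μ → BitString n) (x : BitString n) (hx : zer x = k)
    (hY : (1 - ε) * μ ≤ cnt (fun y => y = x) P) (hJe : (J:ℝ) ≤ ε * μ / 2) (hJ : cnt (near k x) P < J) :
    DX p k (DD a0 η n μ) J P x ≤ -1 := by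
  have ha1 : (1 - p) ^ n ≤ 1 := pow_le_one₀ (by linarith) (by linarith)
  have ha01 : a0 ≤ 1 := ha.trans ha1
  have hε1 : ε ≤ η / 100 := by nlinarith
  have hμ' : (0:ℝ) < μ := by
    by_contra h
    have : (μ:ℝ) ≤ 0 := not_lt.1 h
    nlinarith
  have hμ1 : 1 ≤ μ := by exact_mod_cast hμ'
  have hn' : (0:ℝ) < n := by exact_mod_cast (by omega : 0 < n)
  have hjJ : ((cnt (near k x) P : ℕ):ℝ) ≤ ε * μ / 2 := by
    have : ((cnt (near k x) P : ℕ):ℝ) ≤ J := by exact_mod_cast hJ.le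
    linarith
  have hY4 : 3 * μ + 4 ≤ 4 * cnt (fun y => y = x) P := by
    have : (3 * μ + 4 : ℝ) ≤ 4 * cnt (fun y => y = x) P := by nlinarith
    exact_mod_cast this
  refine (DX_maj h0 h1 (DD_nonneg ha0 hη hn'.le hμ'.le) P x hμ1 hY4 hJ).trans ?_
  have hYμ : ((cnt (fun y => y = x) P : ℕ):ℝ) ≤ μ := by exact_mod_cast cnt_le _ _
  have hq1 := qnear_ge h0 h1 (by omega) P x hx
  have hq2 := qplat_le h0 h1 hμ1 P x hx
  set a := (1 - p) ^ n with hadef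
  have hap : 0 < a := by linarith
  set Y : ℝ := ((cnt (fun y => y = x) P : ℕ):ℝ)
  have hs1 : 1 - ε ≤ Y / μ := by rw [le_div_iff₀ hμ']; exact hY
  have hs2 : Y / μ ≤ 1 := by rw [div_le_iff₀ hμ']; linarith
  have he : ε ≤ 1 / 100 := by linarith
  refine maj_real (ε := ε) ha0 ha hη hη1 hε hε1 hn' hμ' hjJ (by linarith) ?_ ?_
  · refine le_trans ?_ hq1
    set j : ℝ := ((cnt (near k x) P : ℕ):ℝ)
    have hj0 : 0 ≤ j := by positivity
    have e1 : ((μ : ℝ)⁻¹ * (μ : ℝ)⁻¹) * (2 * (Y * (j * (1 / 4 * (1 + (n - k - 1) * p) * a))) + Y * (Y * (k * (n - k) * p ^ 2 * a)))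
      = a * (Y / μ) * ((1 + (n - k - 1) * p) / 2) * (j / μ) + (Y / μ) * (Y / μ) * (k * (n - k) * p ^ 2) * a := by
      field_simp; ring
    rw [e1]
    refine add_le_add ?_ ?_
    · have : 1 + η / 4 ≤ (1 + (n - k - 1) * p) / 2 := by linarith
      have h3 : 0 ≤ 1 - ε := by linarith
      gcongr
    · have hkr : (3:ℝ) ≤ k := by exact_mod_cast hk
      have hknr : 2 * (k:ℝ) ≤ n := by exact_mod_cast hkn
      have e2 : 3 / 2 * (1 / (n:ℝ)) ≤ k * (n - k) * p ^ 2 := by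
        have hpn : 1 / (n:ℝ) ≤ p := by rw [div_le_iff₀ hn']; linarith
        calc 3 / 2 * (1 / (n:ℝ)) = 3 * (n / 2) * (1 / n) ^ 2 := by field_simp
          _ ≤ k * (n - k) * p ^ 2 := by
            have : (n:ℝ) / 2 ≤ n - k := by linarith
            have hnk0 : 0 ≤ (n:ℝ) - k := by linarith
            gcongr
      have hnk0 : 0 ≤ (n:ℝ) - k := by linarith
      have e3 : (99/100) * (99/100) ≤ Y / μ * (Y / μ) := by
        have : 99 / 100 ≤ Y / μ := by linarith
        gcongr
      calc a / n = (2/3) * (3 / 2 * (1 / (n:ℝ))) * a := by field_simp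
        _ ≤ _ := by
          gcongr; linarith
  · refine hq2.trans ?_
    have hb : a + k * p - 1 ≤ 0 ∨ 0 ≤ a + k * p - 1 := le_total _ _
    have hss : 1 - 2 * ε ≤ Y / μ * (Y / μ) := by nlinarith
    have hss1 : Y / μ * (Y / μ) ≤ 1 := by
      have : 0 ≤ Y / μ := by positivity
      nlinarith
    have hkp0 : 0 ≤ k * p := by positivity
    have hh : 1 + Y / μ * (Y / μ) * (a + k * p - 1) ≤ a + k * p + 2 * ε := by
      have : (1 - Y / μ * (Y / μ)) * (1 - a - k * p) ≤ 2 * ε := by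
        calc (1 - Y / μ * (Y / μ)) * (1 - a - k * p) ≤ (1 - Y / μ * (Y / μ)) * 1 := by
              apply mul_le_mul_of_nonneg_left <;> linarith
          _ ≤ 2 * ε := by linarith
      have e5 : 1 + Y / μ * (Y / μ) * (a + k * p - 1) = a + k * p + (1 - Y / μ * (Y / μ)) * (1 - a - k * p) := by ring
      rw [e5]; linarith
    have e6 : a0 * η ≤ a * η := by gcongr
    have e7 : a * (1 + η / 16) = a + a * η / 16 := by ring
    rw [e7]; linarith

/-! ### Phase 2: case analysis -/

lemma cnt_mono {n μ : ℕ} {Q R : BitString n → Prop} (P : Fin μ → BitString n) (h : ∀ i, Q (P i) → R (P i)) :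
    cnt Q P ≤ cnt R P := by
  refine Finset.card_le_card fun i => ?_
  simp only [Finset.mem_filter, Finset.mem_univ, true_and]; exact h i

lemma cnt_le_add {n μ : ℕ} {Q R S : BitString n → Prop} (P : Fin μ → BitString n)
    (h : ∀ i, Q (P i) → R (P i) ∨ S (P i)) : cnt Q P ≤ cnt R P + cnt S P := by
  refine le_trans (Finset.card_le_card ?_) (Finset.card_union_le _ _)
  intro i
  simp only [Finset.mem_filter, Finset.mem_univ, true_and, Finset.mem_union]; exact h i

lemma ham_plateau {n k : ℕ} {u v : BitString n} (hu : zer u = k) (hv : zer v = k) (hne : u ≠ v) :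
    2 ≤ hammingDist u v ∧ (¬ near k u v → 4 ≤ hammingDist u v) := by
  have h2 := two_cz u v
  have h0 : hammingDist u v ≠ 0 := fun h => hne (hammingDist_eq_zero.1 h)
  refine ⟨by omega, fun h => ?_⟩
  have : hammingDist u v ≠ 2 := fun h' => h ⟨hv, h'⟩
  omega

lemma exists_of_cnt {n μ : ℕ} {Q : BitString n → Prop} {P : Fin μ → BitString n} (h : 1 ≤ cnt Q P) :
    ∃ i, Q (P i) := by
  have : (Finset.univ.filter fun i => Q (P i)).Nonempty := Finset.card_pos.1 h
  obtain ⟨i, hi⟩ := this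
  exact ⟨i, by simpa using hi⟩

lemma DX_R {n μ k J : ℕ} {p R : ℝ} (h0 : 0 ≤ p) (h1 : p ≤ 1) {D : ℕ → ℝ} (hD : ∀ i, 0 ≤ D i) (hμ : 6 ≤ μ)
    (hR : 0 ≤ R) (P : Fin μ → BitString n) (x : BitString n)
    (h : μ ≤ 3 * cnt (fun y => y = x) P → cnt (near k x) P ≤ J →
      cnt (near k x) P * D (cnt (near k x) P - 1) / (μ + 1) + 4 / μ * gg D J (cnt (near k x) P) ≤ R) :
    DX p k D J P x ≤ R * (3 * cnt (fun y => y = x) P / μ) := by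
  have hμ' : (0:ℝ) < μ := by exact_mod_cast (by omega : 0 < μ)
  by_cases h3 : 3 * cnt (fun y => y = x) P < μ ∨ J + 1 ≤ cnt (near k x) P
  · rw [DX_zero p D P x hμ h3]; positivity
  · push Not at h3
    refine (DX_gen h0 h1 hD P x (by omega)).trans ((h h3.1 (by omega)).trans ?_)
    have : 1 ≤ 3 * (cnt (fun y => y = x) P : ℝ) / μ := by
      rw [le_div_iff₀ hμ', one_mul]; exact_mod_cast h3.1
    nlinarith

lemma plateau_main {n μ k J : ℕ} {p a0 η ε R0 R1 M : ℝ} (h0 : 0 < p) (h4 : 4 * p ≤ 1) (ha0 : 0 < a0) (ha : a0 ≤ (1 - p) ^ n)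
    (hη : 0 < η) (hη1 : η ≤ 1) (hε : 0 < ε) (hεe : ε ≤ a0 * η / 100) (hk : 3 ≤ k) (hkn : 2 * k ≤ n)
    (hnp : 1 ≤ n * p) (hnk : 1 + η / 2 ≤ (n - k - 1) * p) (hkp : k * p ≤ a0 * η / 32)
    (hμ8 : 8 ≤ ε * μ) (P : Fin μ → BitString n) (hP : ∀ i, zer (P i) = k)
    (hJe : (J:ℝ) ≤ ε * μ / 2) (hJe' : ε * μ / 4 ≤ J) (hR0 : 0 ≤ R0) (hR01 : R0 ≤ R1) (hM : 0 ≤ M)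
    (hJ0 : J * DD a0 η n μ (J - 1) / (μ + 1) ≤ R0)
    (hJ1 : ∀ j < J, j * DD a0 η n μ (j - 1) / (μ + 1) + 4 / μ * gg (DD a0 η n μ) J j ≤ R1)
    (hM0 : 3 * R0 + 1 ≤ M * (ε / 12 * ((1 / 4) ^ 1 * p ^ (k - 1) * (1 - p) ^ n)))
    (hM1 : 3 * R1 + 1 ≤ M * (ε / 6 * ((1 / 4) ^ 2 * p ^ (k - 2) * (1 - p) ^ n))) :
    ∑ x, DX p k (DD a0 η n μ) J P x - M * off p P (allOnes n) ≤ -1 := by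
  have h1 : p ≤ 1 := by linarith
  have ha1 : (1 - p) ^ n ≤ 1 := pow_le_one₀ (by linarith) (by linarith)
  have ha01 : a0 ≤ 1 := ha.trans ha1
  have hε1 : ε ≤ 1 / 100 := by nlinarith
  have hμ' : (0:ℝ) < μ := by
    by_contra h
    have : (μ:ℝ) ≤ 0 := not_lt.1 h
    nlinarith
  have hμ6 : 6 ≤ μ := by
    have : (6:ℝ) ≤ μ := by nlinarith
    exact_mod_cast this
  have hn' : (0:ℝ) < n := by exact_mod_cast (by omega : 0 < n)
  have hD := DD_nonneg ha0 hη hn'.le hμ'.le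
  have hoff := off_nonneg h0.le h1 P (allOnes n)
  have hc1 : 0 ≤ (1 / 4 : ℝ) ^ 1 * p ^ (k - 1) * (1 - p) ^ n := by
    have : 0 ≤ 1 - p := by linarith
    positivity
  have hc2 : 0 ≤ (1 / 4 : ℝ) ^ 2 * p ^ (k - 2) * (1 - p) ^ n := by
    have : 0 ≤ 1 - p := by linarith
    positivity
  have hsumR : ∀ R : ℝ, (∀ x, DX p k (DD a0 η n μ) J P x ≤ R * (3 * cnt (fun y => y = x) P / μ)) →
      ∑ x, DX p k (DD a0 η n μ) J P x ≤ 3 * R := by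
    intro R hR
    refine (Finset.sum_le_sum fun x _ => hR x).trans (le_of_eq ?_)
    have : ∀ x, R * (3 * (cnt (fun y => y = x) P : ℝ) / μ) = (3 * R / μ) * cnt (fun y => y = x) P := by intro x; ring
    simp only [this]
    rw [← Finset.mul_sum, sum_Y]; field_simp
  by_cases hbad : ∃ x, μ ≤ 3 * cnt (fun y => y = x) P ∧ cnt (near k x) P < J
  · obtain ⟨x, hxY, hxJ⟩ := hbad
    have hx : zer x = k := by
      obtain ⟨i, hi⟩ := exists_of_cnt (by omega : 1 ≤ cnt (fun y => y = x) P)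
      rw [← hi]; exact hP i
    by_cases hdom : (1 - ε) * μ ≤ cnt (fun y => y = x) P
    · have hd := DX_dom h0.le h1 ha0 ha hη hη1 hε hεe hk hkn hnp hnk hkp hμ8 P x hx hdom hJe hxJ
      have hs : ∑ x, DX p k (DD a0 η n μ) J P x = DX p k (DD a0 η n μ) J P x := by
        refine Finset.sum_eq_single x (fun x' _ hne => DX_zero p _ P x' hμ6 (Or.inl ?_)) (by simp)
        have e1 := cnt_add_not (fun y => y = x) P
        have e2 : cnt (fun y => y = x') P ≤ cnt (fun y => ¬ y = x) P :=
          cnt_mono P fun i hi => by rw [hi]; exact hne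
        have e3 : ((cnt (fun y => y = x') P : ℕ):ℝ) + cnt (fun y => y = x) P ≤ μ := by exact_mod_cast (by omega)
        have e4 : (3 * cnt (fun y => y = x') P : ℝ) < μ := by nlinarith
        exact_mod_cast e4
      rw [hs]
      nlinarith
    · push Not at hdom
      have hsum := hsumR R1 (fun x => DX_R h0.le h1 hD hμ6 (hR0.trans hR01) P x (by
        intro _ hle
        rcases lt_or_eq_of_le hle with hlt | heq
        · exact hJ1 _ hlt
        · rw [heq, gg_zero le_rfl, mul_zero, add_zero]; exact hJ0.trans hR01))
      have hge := off_ge (c := (1 / 4) ^ 2 * p ^ (k - 2) * (1 - p) ^ n) h0.le h1 P (allOnes n) (fun y => y = x) (fun y => 4 ≤ hammingDist x y) (by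
        intro i j hi hj
        rw [hi]
        exact pm_opt' h0 h4 _ _ hx (hP j) (by omega))
      have e1 := cnt_add_not (fun y => y = x) P
      have e2 : cnt (fun y => ¬ y = x) P ≤ cnt (near k x) P + cnt (fun y => 4 ≤ hammingDist x y) P :=
        cnt_le_add P fun i hi => by
          by_cases hn : near k x (P i)
          · exact Or.inl hn
          · exact Or.inr ((ham_plateau hx (hP i) (Ne.symm hi)).2 hn)
      have e3 : (μ:ℝ) ≤ cnt (fun y => y = x) P + (J + cnt (fun y => 4 ≤ hammingDist x y) P) := by
        exact_mod_cast (by omega)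
      have e4 : ε * μ / 2 ≤ cnt (fun y => 4 ≤ hammingDist x y) P := by linarith
      have e5 : (μ:ℝ) / 3 ≤ cnt (fun y => y = x) P := by
        have : (μ:ℝ) ≤ 3 * cnt (fun y => y = x) P := by exact_mod_cast hxY
        linarith
      set c := (1 / 4 : ℝ) ^ 2 * p ^ (k - 2) * (1 - p) ^ n
      have e6 : ε / 6 * c ≤ off p P (allOnes n) := by
        calc ε / 6 * c = ((μ : ℝ)⁻¹ * (μ : ℝ)⁻¹) * ((μ / 3) * ((ε * μ / 2) * c)) := by field_simp; ring
          _ ≤ ((μ : ℝ)⁻¹ * (μ : ℝ)⁻¹) * (cnt (fun y => y = x) P * (cnt (fun y => 4 ≤ hammingDist x y) P * c)) := by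
            gcongr
          _ ≤ _ := hge
      have := mul_le_mul_of_nonneg_left e6 hM
      linarith
  · push Not at hbad
    have hsum := hsumR R0 (fun x => DX_R h0.le h1 hD hμ6 hR0 P x (by
      intro hle hle2
      have heq : cnt (near k x) P = J := le_antisymm hle2 (hbad x hle)
      rw [heq, gg_zero le_rfl, mul_zero, add_zero]; exact hJ0))
    have e6 : ε / 12 * ((1 / 4 : ℝ) ^ 1 * p ^ (k - 1) * (1 - p) ^ n) ≤ off p P (allOnes n) := by
      by_cases hex : ∃ x, μ ≤ 3 * cnt (fun y => y = x) P
      · obtain ⟨x, hxY⟩ := hex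
        have hxJ := hbad x hxY
        have hx : zer x = k := by
          obtain ⟨i, hi⟩ := exists_of_cnt (by omega : 1 ≤ cnt (fun y => y = x) P)
          rw [← hi]; exact hP i
        have hge := off_ge (c := (1 / 4) ^ 1 * p ^ (k - 1) * (1 - p) ^ n) h0.le h1 P (allOnes n) (fun y => y = x) (near k x) (by
          intro i j hi hj
          rw [hi]
          exact pm_opt' h0 h4 _ _ hx (hP j) (by rw [hj.2]))
        have e4 : ε * μ / 4 ≤ cnt (near k x) P := by
          have : (J:ℝ) ≤ cnt (near k x) P := by exact_mod_cast hxJ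
          linarith
        have e5 : (μ:ℝ) / 3 ≤ cnt (fun y => y = x) P := by
          have : (μ:ℝ) ≤ 3 * cnt (fun y => y = x) P := by exact_mod_cast hxY
          linarith
        set c := (1 / 4 : ℝ) ^ 1 * p ^ (k - 1) * (1 - p) ^ n
        calc ε / 12 * c = ((μ : ℝ)⁻¹ * (μ : ℝ)⁻¹) * ((μ / 3) * ((ε * μ / 4) * c)) := by field_simp; ring
          _ ≤ ((μ : ℝ)⁻¹ * (μ : ℝ)⁻¹) * (cnt (fun y => y = x) P * (cnt (near k x) P * c)) := by
            gcongr
          _ ≤ _ := hge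
      · push Not at hex
        set c := (1 / 4 : ℝ) ^ 1 * p ^ (k - 1) * (1 - p) ^ n with hc
        have hrow : ∀ i, ε / 12 * c * (μ : ℝ)⁻¹ ≤ ∑ j, ((μ : ℝ)⁻¹ * (μ : ℝ)⁻¹) * pm p (P i) (P j) (allOnes n) := by
          intro i
          have e1 := cnt_add_not (fun y => y = P i) P
          have e2 := hex (P i)
          have e3 : (μ:ℝ) / 3 ≤ cnt (fun y => ¬ y = P i) P := by
            have : (μ:ℝ) ≤ 3 * cnt (fun y => ¬ y = P i) P := by exact_mod_cast (by omega)
            linarith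
          rw [← Finset.mul_sum]
          have h13 : ε / 12 ≤ 1 / 3 := by linarith
          calc ε / 12 * c * (μ : ℝ)⁻¹ ≤ (1 / 3) * c * (μ : ℝ)⁻¹ :=
                mul_le_mul_of_nonneg_right (mul_le_mul_of_nonneg_right h13 hc1) (by positivity)
            _ = (μ : ℝ)⁻¹ * (μ : ℝ)⁻¹ * (μ / 3 * c) := by field_simp
            _ ≤ (μ : ℝ)⁻¹ * (μ : ℝ)⁻¹ * (cnt (fun y => ¬ y = P i) P * c) := by gcongr
            _ ≤ _ := by
              rw [← sum_cnt]
              refine mul_le_mul_of_nonneg_left (Finset.sum_le_sum fun j _ => ?_) (by positivity)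
              split_ifs with hj
              · exact pm_nonneg h0.le h1 _ _ _
              · exact pm_opt' h0 h4 _ _ (hP i) (hP j) (by
                  have := (ham_plateau (hP i) (hP j) (Ne.symm hj)).1
                  omega)
        calc ε / 12 * c = ∑ i : Fin μ, ε / 12 * c * (μ : ℝ)⁻¹ := by
              simp only [Finset.sum_const, Finset.card_univ, Fintype.card_fin, nsmul_eq_mul]; field_simp
          _ ≤ _ := Finset.sum_le_sum fun i _ => hrow i
    have := mul_le_mul_of_nonneg_left e6 hM
    linarith

/-! ### Full potential -/

/-- full Lyapunov function -/
def VV {n μ : ℕ} (k : ℕ) (a : ℝ) (D : ℕ → ℝ) (J : ℕ) (M : ℝ) (s : State n μ) : ℝ :=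
  if s.2 = true then 0 else WW k a s.1 + M + if (∀ i, zer (s.1 i) = k) then GG k D J s.1 else 2 * gg D J 0

lemma GG_max {n μ k J : ℕ} {D : ℕ → ℝ} (hD : ∀ i, 0 ≤ D i) (hμ : 1 ≤ μ) (P : Fin μ → BitString n) :
    GG k D J P ≤ 2 * gg D J 0 := by
  have hμ' : (0:ℝ) < μ := by exact_mod_cast hμ
  have hx : ∀ x, GX k D J x P ≤ (cnt (fun y => y = x) P : ℝ) * (2 / μ * gg D J 0) := by
    intro x
    have h1 : phi μ (cnt (fun y => y = x) P) ≤ (cnt (fun y => y = x) P : ℝ) * (2 / μ) := by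
      by_cases h : 2 * cnt (fun y => y = x) P ≤ μ
      · rw [phi_zero hμ h]; positivity
      · refine (phi_le_one _ _).trans ?_
        rw [mul_div_assoc', le_div_iff₀ hμ']
        have : (μ:ℝ) ≤ 2 * cnt (fun y => y = x) P := by exact_mod_cast (by omega)
        linarith
    rw [← mul_assoc]
    exact mul_le_mul h1 (gg_anti hD (Nat.zero_le _)) (gg_nonneg hD _ _) (by positivity)
  refine (Finset.sum_le_sum fun x _ => hx x).trans (le_of_eq ?_)
  rw [← Finset.sum_mul, sum_Y]; field_simp

lemma GG_nonneg {n μ k J : ℕ} {D : ℕ → ℝ} (hD : ∀ i, 0 ≤ D i) (P : Fin μ → BitString n) :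
    0 ≤ GG k D J P := Finset.sum_nonneg fun x _ => GX_nonneg hD J x P

lemma VV_le {n μ k J : ℕ} {a M : ℝ} {D : ℕ → ℝ} (ha : 0 < a) (hM : 0 ≤ M) (hD : ∀ i, 0 ≤ D i) (hμ : 1 ≤ μ) (s : State n μ) :
    0 ≤ VV k a D J M s ∧ VV k a D J M s ≤ WW k a s.1 + M + 2 * gg D J 0 := by
  have h1 := WW_nonneg (k := k) ha s.1
  have h2 := GG_nonneg (k := k) (J := J) hD s.1
  have h3 := GG_max (k := k) (J := J) hD hμ s.1
  unfold VV
  split_ifs <;> constructor <;> linarith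

lemma snoc_cases {μ : ℕ} (j : Fin (μ + 1)) : j = Fin.last μ ∨ ∃ i : Fin μ, j = i.castSucc := by
  refine Fin.lastCases (Or.inl rfl) (fun i => Or.inr ⟨i, rfl⟩) j

lemma removeAt_last {n μ : ℕ} (P : Fin μ → BitString n) (y : BitString n) : removeAt P y (Fin.last μ) = P := by
  simp [removeAt]

lemma removeAt_castSucc {n μ : ℕ} (P : Fin μ → BitString n) (y : BitString n) (i : Fin μ) :
    removeAt P y i.castSucc = Function.update P i y := by
  simp [removeAt]

lemma VV_drift {n μ k J : ℕ} {p M : ℝ} {D : ℕ → ℝ} (h0 : 0 ≤ p) (h1 : p < 1) (hn : (1:ℝ) ≤ n * p) (hk : 1 ≤ k)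
    (hkn : 2 * k ≤ n) (hμ : 1 ≤ μ) (hM : 0 ≤ M) (hD : ∀ i, 0 ≤ D i) (P : Fin μ → BitString n)
    (hv : ∀ i, P i ≠ allOnes n)
    (hmain : (∀ i, zer (P i) = k) → ∑ x, DX p k D J P x - M * off p P (allOnes n) ≤ -1) :
    1 + ∑ y, off p P y * avg k P y (fun j => VV k ((1 - p) ^ n) D J M (removeAt P y j, false || decide (y = allOnes n)))
      ≤ VV k ((1 - p) ^ n) D J M (P, false) := by
  have ha : 0 < (1 - p) ^ n := pow_pos (by linarith) n
  set a := (1 - p) ^ n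
  by_cases hpl : ∀ i, zer (P i) = k
  · have hV : VV k a D J M (P, false) = WW k a P + M + GG k D J P := by simp [VV, hpl]
    rw [hV]
    have hW := WW_nonneg (k := k) ha P
    have hG := GG_nonneg (k := k) (J := J) hD P
    have hpt : ∀ y, avg k P y (fun j => VV k a D J M (removeAt P y j, false || decide (y = allOnes n))) ≤
        (WW k a P + M + GG k D J P) - M * (if y = allOnes n then 1 else 0) +
        (if zer y = k then ((μ : ℝ) + 1)⁻¹ * ∑ r, (GG k D J (removeAt P y r) - GG k D J P) else 0) := by
      intro y
      by_cases hy1 : y = allOnes n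
      · have hz : ¬ zer y = k := by rw [(zer_eq_zero y).2 hy1]; omega
        rw [if_pos hy1, if_neg hz]
        refine avg_le fun j _ => ?_
        simp only [VV, hy1]
        simp
        linarith
      · rw [if_neg hy1]
        by_cases hz : zer y = k
        · rw [if_pos hz]
          have hjmp : ∀ j, jump n k ((Fin.snoc P y : Fin (μ + 1) → BitString n) j) = n := by
            intro j
            rcases snoc_cases j with rfl | ⟨i, rfl⟩
            · rw [Fin.snoc_last]; exact (jump_eq_n y hy1 (by omega)).2 hz
            · rw [Fin.snoc_castSucc]; exact (jump_eq_n _ (hv i) (by omega)).2 (hpl i)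
          have hw : worst k P y = Finset.univ := by
            ext j; simp [worst, hjmp]
          have hpl' : ∀ r i, zer (removeAt P y r i) = k := by
            intro r i
            rcases snoc_cases r with rfl | ⟨i', rfl⟩
            · rw [removeAt_last]; exact hpl i
            · rw [removeAt_castSucc]
              by_cases h : i = i'
              · subst h; simpa using hz
              · rw [Function.update_of_ne h]; exact hpl i
          have hVr : ∀ r, VV k a D J M (removeAt P y r, false || decide (y = allOnes n)) ≤
              (WW k a P + M + GG k D J P) + (GG k D J (removeAt P y r) - GG k D J P) := by
            intro r
            have := WW_mono (k := k) ha (j := r) (P := P) (y := y) (by rw [hw]; simp)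
            simp only [VV, hy1, hpl']
            simp
            linarith
          have hμ1 : (0:ℝ) < μ + 1 := by positivity
          rw [avg, hw, ← Finset.mul_sum]
          simp only [Finset.card_univ, Fintype.card_fin]
          push_cast
          calc _ ≤ ((μ:ℝ) + 1)⁻¹ * ∑ r : Fin (μ + 1), ((WW k a P + M + GG k D J P) + (GG k D J (removeAt P y r) - GG k D J P)) := by
                refine mul_le_mul_of_nonneg_left (Finset.sum_le_sum fun r _ => hVr r) (by positivity)
            _ = _ := by
                rw [Finset.sum_add_distrib, mul_add]
                simp only [Finset.sum_const, Finset.card_univ, Fintype.card_fin, nsmul_eq_mul]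
                push_cast
                field_simp
                ring
        · rw [if_neg hz]
          refine avg_le fun j hj => ?_
          have hjl : j = Fin.last μ := by
            rcases snoc_cases j with h | ⟨i, rfl⟩
            · exact h
            · exfalso
              have h2 := (mem_worst hj).2
              rw [Fin.snoc_castSucc, (jump_eq_n _ (hv i) (by omega)).2 (hpl i)] at h2
              have h3 := jump_le_n (k := k) y hy1 (by omega)
              have h4 := (jump_eq_n (k := k) y hy1 (by omega)).not.2 hz
              omega
          rw [hjl, removeAt_last]
          simp [VV, hy1, hpl]
    have hsum := Finset.sum_le_sum fun y (_ : y ∈ Finset.univ) => mul_le_mul_of_nonneg_left (hpt y) (off_nonneg h0 h1.le P y)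
    have he : ∑ y, off p P y * ((WW k a P + M + GG k D J P) - M * (if y = allOnes n then 1 else 0) +
        (if zer y = k then ((μ : ℝ) + 1)⁻¹ * ∑ r, (GG k D J (removeAt P y r) - GG k D J P) else 0))
        = (WW k a P + M + GG k D J P) - M * off p P (allOnes n) + ∑ x, DX p k D J P x := by
      rw [← GG_drift]
      simp only [mul_add, Finset.sum_add_distrib, mul_sub, Finset.sum_sub_distrib]
      rw [← Finset.sum_mul, ← Finset.sum_mul, ← Finset.sum_mul, off_sum hμ]
      have : ∑ y, off p P y * (M * (if y = allOnes n then (1:ℝ) else 0)) = M * off p P (allOnes n) := by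
        rw [Finset.sum_eq_single (allOnes n)]
        · simp; ring
        · intro y _ hy; simp [hy]
        · simp
      rw [this]
      ring
    rw [he] at hsum
    have := hmain hpl
    linarith
  · have hV : VV k a D J M (P, false) = WW k a P + M + 2 * gg D J 0 := by simp [VV, hpl]
    rw [hV]
    have hd := WW_drift h0 h1 hn hk hkn hμ P hv hpl
    have hpt : ∀ y, avg k P y (fun j => VV k a D J M (removeAt P y j, false || decide (y = allOnes n))) ≤
        avg k P y (fun j => WW k a (removeAt P y j)) + (M + 2 * gg D J 0) := by
      intro y
      have hc : 0 < ((worst k P y).card : ℝ) := by exact_mod_cast (worst_nonempty k P y).card_pos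
      have : avg k P y (fun j => WW k a (removeAt P y j)) + (M + 2 * gg D J 0) =
          avg k P y (fun j => WW k a (removeAt P y j) + (M + 2 * gg D J 0)) := by
        simp only [avg, mul_add, Finset.sum_add_distrib]
        congr 1
        rw [Finset.sum_const, Finset.sum_const, nsmul_eq_mul, nsmul_eq_mul]
        field_simp
      rw [this]
      refine Finset.sum_le_sum fun j _ => mul_le_mul_of_nonneg_left ?_ (by positivity)
      have := (VV_le (k := k) (J := J) ha hM hD hμ (removeAt P y j, false || decide (y = allOnes n))).2
      linarith
    have hsum := Finset.sum_le_sum fun y (_ : y ∈ Finset.univ) => mul_le_mul_of_nonneg_left (hpt y) (off_nonneg h0 h1.le P y)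
    simp only [mul_add (off p P _), Finset.sum_add_distrib] at hsum
    rw [← Finset.sum_mul, ← Finset.sum_mul, off_sum hμ] at hsum
    linarith

/-! ### Assembly -/

lemma init_sum (n μ : ℕ) : ∑ s, init n μ s = 1 := by
  rw [Fintype.sum_prod_type]
  simp only [init]
  have : ∀ P : Fin μ → BitString n, ∑ b : Bool, ((2 : ℝ≥0∞) ^ (n * μ))⁻¹ *
      (if b = decide (∃ i, P i = allOnes n) then 1 else 0) = ((2 : ℝ≥0∞) ^ (n * μ))⁻¹ := by
    intro P
    rw [← Finset.mul_sum, Finset.sum_ite_eq']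
    simp
  simp only [this]
  rw [Finset.sum_const, Finset.card_univ, nsmul_eq_mul]
  simp only [Fintype.card_fun, Fintype.card_fin, Fintype.card_bool]
  push_cast
  rw [← pow_mul]
  exact ENNReal.mul_inv_cancel (by positivity) (by finiteness)

lemma trans_ne {n μ k : ℕ} {p : ℝ} {s s' : State n μ} (h : trans n μ k p s s' ≠ 0) :
    ∃ y j, s' = (removeAt s.1 y j, s.2 || decide (y = allOnes n)) := by
  by_contra hc
  push Not at hc
  apply h
  have e := trans_sum0 (k := k) p s (fun t => if t = s' then 1 else 0)
  rw [Finset.sum_eq_single s' (by intro b _ hb; simp [hb]) (by simp)] at e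
  rw [if_pos rfl, mul_one] at e
  rw [e]
  have : ∀ y j, (if ((removeAt s.1 y j, s.2 || decide (y = allOnes n)) : State n μ) = s' then (1:ℝ≥0∞) else 0) = 0 := by
    intro y j; exact if_neg (hc y j).symm
  simp only [this]
  simp

lemma expOpt_le {n μ k J : ℕ} {p M : ℝ} {D : ℕ → ℝ} (h0 : 0 < p) (h1 : p < 1) (hn : (1:ℝ) ≤ n * p) (hk : 3 ≤ k)
    (hkn : 2 * k ≤ n) (hμ : 1 ≤ μ) (hM : 0 ≤ M) (hD : ∀ i, 0 ≤ D i)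
    (hmain : ∀ P : Fin μ → BitString n, (∀ i, zer (P i) = k) →
      ∑ x, DX p k D J P x - M * off p P (allOnes n) ≤ -1) :
    expOpt n μ k p ≤ ENNReal.ofReal (8 * k / (1 - p) ^ n * (n ^ 2 + 4 * (n * μ)) + M + 2 * gg D J 0) := by
  have ha : 0 < (1 - p) ^ n := by have : 0 < 1 - p := by linarith
                                  positivity
  set U := 8 * k / (1 - p) ^ n * (n ^ 2 + 4 * (n * μ)) + M + 2 * gg D J 0 with hU
  have hVV := fun s : State n μ => VV_le (k := k) (J := J) ha hM hD hμ s
  refine (lyap (init n μ) (trans n μ k p) (fun s => ENNReal.ofReal (VV k ((1 - p) ^ n) D J M s))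
    (fun s => s.2 = false → ∀ i, s.1 i ≠ allOnes n) (fun s => ¬ s.2 = true) ?_ ?_ ?_).trans ?_
  · intro s hs hf i hi
    apply hs
    have : s.2 ≠ decide (∃ i, s.1 i = allOnes n) := by
      rw [hf]
      have : ∃ i, s.1 i = allOnes n := ⟨i, hi⟩
      simp [this]
    simp only [init]
    rw [if_neg this, mul_zero]
  · intro s s' hs ht hf i
    obtain ⟨y, j, rfl⟩ := trans_ne ht
    simp only [Bool.or_eq_false_iff, decide_eq_false_iff_not] at hf
    have hs := hs hf.1
    simp only [removeAt]
    split_ifs with hj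
    · by_cases hij : i = ⟨j.val, hj⟩
      · subst hij; rw [Function.update_self]; exact hf.2
      · rw [Function.update_of_ne hij]; exact hs i
    · exact hs i
  · rintro ⟨P, b⟩ hs
    rw [trans_sum hμ h0.le h1.le _ _ (fun s => (hVV s).1)]
    cases b with
    | true =>
      have : ∀ Q : Fin μ → BitString n, VV k ((1 - p) ^ n) D J M (Q, true) = 0 := by
        intro Q; simp [VV]
      simp only [Bool.true_or, this]
      simp [avg]
    | false =>
      have hv := hs rfl
      have hd := VV_drift (J := J) h0.le h1 hn (by omega) hkn hμ hM hD P hv (hmain P)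
      simp only [Bool.false_eq_true, not_false_eq_true, if_true]
      rw [← ENNReal.ofReal_one, ← ENNReal.ofReal_add zero_le_one]
      · exact ENNReal.ofReal_le_ofReal hd
      · refine Finset.sum_nonneg fun y _ => mul_nonneg (off_nonneg h0.le h1.le _ _) ?_
        simp only [avg]
        first
        | exact mul_nonneg (by positivity) (Finset.sum_nonneg fun j _ => (hVV _).1)
        | exact div_nonneg (Finset.sum_nonneg fun j _ => (hVV _).1) (by positivity)
        | exact (Finset.sum_nonneg fun j _ => mul_nonneg (by positivity) (hVV _).1)
  · calc ∑ s, init n μ s * ENNReal.ofReal (VV k ((1 - p) ^ n) D J M s) ≤ ∑ s, init n μ s * ENNReal.ofReal U := by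
          refine Finset.sum_le_sum fun s _ => ?_
          gcongr
          have := (hVV s).2
          have := WW_max (k := k) ha s.1
          linarith
      _ = ENNReal.ofReal U := by rw [← Finset.sum_mul, init_sum, one_mul]

/-! ### Constants -/

lemma gg_DD_le {a0 η n : ℝ} {μ J : ℕ} (ha : 0 < a0) (hη : 0 < η) (hη1 : η ≤ 1) (hn : 0 ≤ n) (hμ : 1 ≤ μ) (hJ : J ≤ μ) :
    gg (DD a0 η n μ) J 0 ≤ 2 / a0 * (1 - (1 + η / 16) / (1 + η / 8))⁻¹ * n +
      (64 * (64 / η) / (a0 * η)) * μ * (1 + Real.log μ) := by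
  set r := (1 + η / 16) / (1 + η / 8) with hr
  have hr0 : 0 ≤ r := by positivity
  have hr1 : r < 1 := by rw [hr, div_lt_one (by positivity)]; linarith
  have e1 : ∑ i ∈ Finset.range J, r ^ i ≤ (1 - r)⁻¹ := by
    rw [← tsum_geometric_of_lt_one hr0 hr1]
    exact (summable_geometric_of_lt_one hr0 hr1).sum_le_tsum _ (fun i _ => by positivity)
  have h64 : 1 ≤ 64 / η := by rw [le_div_iff₀ hη]; linarith
  have e2 : ∑ i ∈ Finset.range J, ((i:ℝ) + 64 / η)⁻¹ ≤ 1 + Real.log μ := by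
    calc ∑ i ∈ Finset.range J, ((i:ℝ) + 64 / η)⁻¹ ≤ ∑ i ∈ Finset.range μ, ((i:ℝ) + 1)⁻¹ := by
          refine (Finset.sum_le_sum_of_subset_of_nonneg (Finset.range_mono hJ) (fun i _ _ => by positivity)).trans ?_
          exact Finset.sum_le_sum fun i _ => by gcongr
      _ = ((harmonic μ : ℚ) : ℝ) := by simp [harmonic]
      _ ≤ _ := harmonic_le_one_add_log μ
  have e : gg (DD a0 η n μ) J 0 = 2 / a0 * n * ∑ i ∈ Finset.range J, r ^ i +
      (64 * (64 / η) / (a0 * η)) * μ * ∑ i ∈ Finset.range J, ((i:ℝ) + 64 / η)⁻¹ := by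
    rw [gg, ← Finset.range_eq_Ico, Finset.mul_sum, Finset.mul_sum, ← Finset.sum_add_distrib]
    rfl
  rw [e]
  have f1 : 2 / a0 * n * ∑ i ∈ Finset.range J, r ^ i ≤ 2 / a0 * n * (1 - r)⁻¹ := by gcongr
  have f2 : (64 * (64 / η) / (a0 * η)) * μ * ∑ i ∈ Finset.range J, ((i:ℝ) + 64 / η)⁻¹ ≤
    (64 * (64 / η) / (a0 * η)) * μ * (1 + Real.log μ) := by gcongr
  linarith

lemma DD_mul_le {a0 η n : ℝ} {μ j : ℕ} (ha : 0 < a0) (hη : 0 < η) (hη1 : η ≤ 1) (hn : 0 ≤ n) (hj : j ≤ μ) :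
    j * DD a0 η n μ (j - 1) / (μ + 1) ≤ 2 / a0 * n * ((1 + η / 16) / (1 + η / 8)) ^ (j - 1) + 64 * (64 / η) / (a0 * η) := by
  have h64 : 1 ≤ 64 / η := by rw [le_div_iff₀ hη]; linarith
  have hjμ : (j:ℝ) ≤ μ := by exact_mod_cast hj
  set B := 64 * (64 / η) / (a0 * η) with hB
  have hB0 : 0 ≤ B := by positivity
  set X := 2 / a0 * n * ((1 + η / 16) / (1 + η / 8)) ^ (j - 1) with hX
  have hX0 : 0 ≤ X := by positivity
  have hDD : DD a0 η n μ (j - 1) = X + B * μ / (((j - 1 : ℕ) : ℝ) + 64 / η) := rfl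
  have hj1 : (j:ℝ) ≤ ((j - 1 : ℕ) : ℝ) + 64 / η := by
    have : (j:ℝ) ≤ ((j - 1 : ℕ) : ℝ) + 1 := by exact_mod_cast (by omega)
    linarith
  have hpos : 0 < ((j - 1 : ℕ) : ℝ) + 64 / η := by positivity
  rw [hDD, div_le_iff₀ (by positivity)]
  have t1 : (j:ℝ) * X ≤ X * (μ + 1) := by nlinarith
  have t2 : (j:ℝ) * (B * μ / (((j - 1 : ℕ) : ℝ) + 64 / η)) ≤ B * μ := by
    rw [mul_div_assoc', div_le_iff₀ hpos]
    have : 0 ≤ B * μ := by positivity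
    nlinarith
  nlinarith

lemma k_sq_le {n k : ℕ} (hn : 2 ≤ n) (hk : 3 ≤ k) : k ^ 2 ≤ 9 * n ^ (k - 3) := by
  have h : ∀ m : ℕ, (m + 3) ^ 2 ≤ 9 * 2 ^ m := by
    intro m
    induction m with
    | zero => norm_num
    | succ m ih => have e : 9 * 2 ^ (m + 1) = 2 * (9 * 2 ^ m) := by ring
                   have e2 : (m + 1 + 3) ^ 2 ≤ 2 * (m + 3) ^ 2 := by ring_nf; nlinarith
                   omega
  have := h (k - 3)
  rw [Nat.sub_add_cancel hk] at this
  exact this.trans (Nat.mul_le_mul_left _ (Nat.pow_le_pow_left hn _))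

set_option maxHeartbeats 800000 in
lemma final_pt {δ η a0 ε : ℝ} (hηδ : η ≤ δ) (hη : 0 < η) (hη1 : η ≤ 1) (ha0 : 0 < a0) (ha01 : a0 ≤ 1)
    (hε : 0 < ε) (hεe : ε ≤ a0 * η / 100) :
    ∃ C : ℝ, 0 < C ∧ ∀ n k μ : ℕ, 3 ≤ k → 2 * k ≤ n → ∀ p : ℝ, p = (1 + δ) / n → 4 * p ≤ 1 → a0 ≤ (1 - p) ^ n →
      1 + η / 2 ≤ (n - k - 1) * p → k * p ≤ a0 * η / 32 → 8 ≤ ε * μ →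
      2 / a0 * n * ((1 + η / 16) / (1 + η / 8)) ^ (⌊ε * μ / 2⌋₊ - 1) ≤ 1 →
      expOpt n μ k p ≤ ENNReal.ofReal (C * ((μ : ℝ) ^ 2 + (n : ℝ) ^ (k - 1))) := by
  set A := 2 / a0 with hA
  set B := 64 * (64 / η) / (a0 * η) with hB
  set r := (1 + η / 16) / (1 + η / 8) with hr
  set Q := (1 - r)⁻¹ with hQ
  have hr0 : 0 ≤ r := by positivity
  have hr1 : r < 1 := by rw [hr, div_lt_one (by positivity)]; linarith
  have hQ0 : 0 < Q := by rw [hQ, inv_pos]; linarith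
  have hA0 : 0 < A := by positivity
  have hA1 : 1 ≤ A := by rw [hA, le_div_iff₀ ha0]; linarith
  have hB0 : 0 < B := by positivity
  have hGG : ∀ n μ J : ℕ, 1 ≤ μ → J ≤ μ → gg (DD a0 η n μ) J 0 ≤ A * Q * n + B * μ * (1 + Real.log μ) :=
    fun n μ J h1 h2 => gg_DD_le ha0 hη hη1 (Nat.cast_nonneg n) h1 h2
  have hDM : ∀ n μ j : ℕ, j ≤ μ → j * DD a0 η n μ (j - 1) / (μ + 1) ≤ A * n * r ^ (j - 1) + B :=
    fun n μ j h => DD_mul_le ha0 hη hη1 (Nat.cast_nonneg n) h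
  clear_value A B r Q
  set C1 := 3 * A + 12 * A * Q + 15 * B + 1 with hC1
  have hC10 : 0 < C1 := by positivity
  set K := (576 * C1 + 48 * (4 + 3 * B)) / (ε * a0 * η) with hK
  have hK0 : 0 < K := by positivity
  have hKe : K * (ε * a0 * η) = 576 * C1 + 48 * (4 + 3 * B) := by rw [hK]; field_simp
  clear_value C1 K
  refine ⟨216 / a0 + K + 2 * A * Q + 2 * B, by positivity, ?_⟩
  intro n k μ hk hkn p hp h4 ha hnk hkp hμ8 hr'
  have hn6 : 6 ≤ n := by omega
  have hnR : (6:ℝ) ≤ n := by exact_mod_cast hn6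
  have hn0 : (0:ℝ) < n := by linarith
  have hp0 : 0 < p := by rw [hp]; have : 0 < 1 + δ := by linarith
                         positivity
  have hnp' : n * p = 1 + δ := by rw [hp]; field_simp
  have hnp : 1 ≤ n * p := by linarith
  have hε1 : ε ≤ 1 / 100 := by
    have h1 : a0 * η ≤ 1 := mul_le_one₀ ha01 hη.le hη1
    linarith only [h1, hεe]
  have hμR : (800:ℝ) ≤ μ := by
    have h1 : ε * μ ≤ 1 / 100 * μ := mul_le_mul_of_nonneg_right hε1 (Nat.cast_nonneg μ)
    linarith only [h1, hμ8]
  have hμ0 : (0:ℝ) < μ := by linarith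
  have hμ1 : 1 ≤ μ := by have : (1:ℝ) ≤ μ := by linarith
                         exact_mod_cast this
  set J := ⌊ε * μ / 2⌋₊ with hJ
  have hJe : (J:ℝ) ≤ ε * μ / 2 := Nat.floor_le (by positivity)
  have hJe' : ε * μ / 4 ≤ J := by
    have := Nat.lt_floor_add_one (ε * μ / 2)
    rw [← hJ] at this
    linarith
  clear_value J
  have hJμ : J ≤ μ := by
    have h1 : ε * μ ≤ 1 / 100 * μ := mul_le_mul_of_nonneg_right hε1 hμ0.le
    have : (J:ℝ) ≤ μ := by linarith only [h1, hJe, hμ0]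
    exact_mod_cast this
  have hlog0 : 0 ≤ Real.log μ := Real.log_nonneg (by linarith)
  have hlog1 : Real.log μ ≤ μ - 1 := Real.log_le_sub_one_of_pos hμ0
  have hD : ∀ i, 0 ≤ DD a0 η n μ i := DD_nonneg ha0 hη hn0.le hμ0.le
  have hG0 : gg (DD a0 η n μ) J 0 ≤ A * Q * n + B * μ * (1 + Real.log μ) := hGG n μ J hμ1 hJμ
  set N : ℝ := (n:ℝ) ^ (k - 2) with hN
  have hN0 : 0 < N := by positivity
  have hNn : (n:ℝ) ^ (k - 1) = N * n := by rw [hN, ← pow_succ]; congr 1; omega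
  set S : ℝ := (μ:ℝ) ^ 2 + N * n with hS
  have hS0 : 0 < S := by positivity
  clear_value S N
  have hM : 0 ≤ K * S := by positivity
  have ha1 : 0 < (1 - p) ^ n := lt_of_lt_of_le ha0 ha
  -- log bound
  have hlogN : Real.log μ * N ≤ k * (n * N) + (μ:ℝ) ^ 2 := by
    by_cases hc : (μ:ℝ) ≤ (n:ℝ) ^ k
    · have h1 : Real.log μ ≤ k * Real.log n := by
        rw [← Real.log_pow]; exact Real.log_le_log hμ0 hc
      have h2 : Real.log n ≤ n := (Real.log_le_sub_one_of_pos hn0).trans (by linarith)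
      have h3 : Real.log μ ≤ k * n := h1.trans (by gcongr)
      have := mul_le_mul_of_nonneg_right h3 hN0.le
      have := sq_nonneg (μ:ℝ)
      linarith
    · push Not at hc
      have h1 : N ≤ μ := by
        rw [hN]
        exact (pow_le_pow_right₀ (by linarith) (by omega)).trans hc.le
      have h2 : Real.log μ * N ≤ μ * μ := mul_le_mul (by linarith only [hlog1]) h1 hN0.le hμ0.le
      have : 0 ≤ (k:ℝ) * (n * N) := by positivity
      have h3 : (μ:ℝ) * μ = (μ:ℝ) ^ 2 := by ring
      linarith
  have hkR : (3:ℝ) ≤ k := by exact_mod_cast hk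
  -- powers of p
  have hpN : η * k / 3 ≤ p ^ (k - 2) * N := by
    rw [hN, ← mul_pow, mul_comm p, hnp']
    have hb := one_add_mul_le_pow (by linarith : (-2:ℝ) ≤ δ) (k - 2)
    have hc : ((k - 2 : ℕ) : ℝ) = k - 2 := by push_cast [Nat.cast_sub (by omega : 2 ≤ k)]; ring
    rw [hc] at hb
    have h1 : ((k:ℝ) - 2) * η ≤ (k - 2) * δ := mul_le_mul_of_nonneg_left hηδ (by linarith)
    have h2 : 0 ≤ η * ((k:ℝ) - 3) := mul_nonneg hη.le (by linarith)
    linarith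
  have hpn1 : 1 ≤ p ^ (k - 1) * (N * n) := by
    rw [← hNn, ← mul_pow, mul_comm p]
    exact one_le_pow₀ hnp
  set R1 := A * n + B + 4 * A * Q * n + 4 * B * (1 + Real.log μ) with hR1
  clear_value R1
  have hmain : ∀ P : Fin μ → BitString n, (∀ i, zer (P i) = k) →
      ∑ x, DX p k (DD a0 η n μ) J P x - K * S * off p P (allOnes n) ≤ -1 := by
    intro P hP
    refine plateau_main (R0 := 1 + B) (R1 := R1) hp0 h4 ha0 ha hη hη1 hε hεe hk hkn hnp hnk hkp hμ8 P hP hJe hJe' (by positivity) ?_ hM ?_ ?_ ?_ ?_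
    · have : 1 ≤ A * n := one_le_mul_of_one_le_of_one_le hA1 (by linarith only [hnR])
      have : 0 ≤ 4 * A * Q * n := by positivity
      have : 0 ≤ 4 * B * (1 + Real.log μ) := by positivity
      linarith
    · have := hDM n μ J hJμ
      linarith only [this, hr']
    · intro j hj
      have t1 := hDM n μ j (hj.le.trans hJμ)
      have t2 : A * n * r ^ (j - 1) ≤ A * n := mul_le_of_le_one_right (by positivity) (pow_le_one₀ hr0 hr1.le)
      have t3 : gg (DD a0 η n μ) J j ≤ A * Q * n + B * μ * (1 + Real.log μ) := (gg_anti hD (Nat.zero_le j)).trans hG0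
      have t4 : 4 / (μ:ℝ) * gg (DD a0 η n μ) J j ≤ 4 / μ * (A * Q * n + B * μ * (1 + Real.log μ)) := by gcongr
      have t5 : 4 / (μ:ℝ) * (A * Q * n + B * μ * (1 + Real.log μ)) = 4 / μ * (A * Q * n) + 4 * B * (1 + Real.log μ) := by field_simp
      have t6 : 4 / (μ:ℝ) ≤ 4 := by rw [div_le_iff₀ hμ0]; linarith
      have t7 : 4 / (μ:ℝ) * (A * Q * n) ≤ 4 * (A * Q * n) := by gcongr
      linarith only [t1, t2, t4, t5, t7, hR1]
    · have t1 : K * S * (ε / 12 * ((1 / 4) ^ 1 * p ^ (k - 1) * (1 - p) ^ n)) = K * ε / 48 * (1 - p) ^ n * (p ^ (k - 1) * S) := by ring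
      have t2 : 1 ≤ p ^ (k - 1) * S := by
        have : 0 ≤ p ^ (k - 1) * (μ:ℝ) ^ 2 := by positivity
        rw [hS, mul_add]; linarith only [this, hpn1]
      have t3 : K * ε / 48 * a0 * 1 ≤ K * ε / 48 * (1 - p) ^ n * (p ^ (k - 1) * S) := by gcongr
      rw [t1]
      have t4 : K * (ε * a0 * η) ≤ K * (ε * a0) := by
        exact mul_le_mul_of_nonneg_left (mul_le_of_le_one_right (by positivity) hη1) hK0.le
      linarith only [t3, t4, hKe, hC10, hB0]
    · have t1 : K * S * (ε / 6 * ((1 / 4) ^ 2 * p ^ (k - 2) * (1 - p) ^ n)) * N = K * ε / 96 * (1 - p) ^ n * ((p ^ (k - 2) * N) * S) := by ring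
      have t3 : K * ε / 96 * a0 * (η * k / 3 * S) ≤ K * ε / 96 * (1 - p) ^ n * ((p ^ (k - 2) * N) * S) := by gcongr
      have t4 : K * ε / 96 * a0 * (η * k / 3 * S) = K * (ε * a0 * η) / 288 * (k * S) := by ring
      have t5 : 2 * C1 * (k * S) ≤ K * (ε * a0 * η) / 288 * (k * S) := by
        refine mul_le_mul_of_nonneg_right ?_ (by positivity)
        linarith only [hKe, hB0]
      have t6 : 3 * R1 + 1 ≤ C1 * (n + Real.log μ) := by
        have u1 : B ≤ B * n := le_mul_of_one_le_right hB0.le (by linarith)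
        have u2 : 0 ≤ A * Real.log μ := by positivity
        have u3 : 0 ≤ A * Q * Real.log μ := by positivity
        have u4 : 0 ≤ B * Real.log μ := by positivity
        have u5 : C1 * (n + Real.log μ) = 3 * (A * n) + 12 * (A * Q * n) + 15 * (B * n) + n + 3 * (A * Real.log μ) + 12 * (A * Q * Real.log μ) + 15 * (B * Real.log μ) + Real.log μ := by rw [hC1]; ring
        rw [u5, hR1]; linarith only [u1, u2, u3, u4, hlog0, hnR]
      have t7 : (n + Real.log μ) * N ≤ 2 * (k * S) := by
        have u1 : (n:ℝ) * N ≤ k * (n * N) := le_mul_of_one_le_left (by positivity) (by linarith)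
        have u2 : (μ:ℝ) ^ 2 ≤ k * (μ:ℝ) ^ 2 := le_mul_of_one_le_left (by positivity) (by linarith)
        have u3 : 2 * (k * S) = 2 * (k * (μ:ℝ) ^ 2) + 2 * (k * (n * N)) := by rw [hS]; ring
        have u4 : (n + Real.log μ) * N = n * N + Real.log μ * N := by ring
        have u5 : 0 ≤ (k:ℝ) * (μ:ℝ) ^ 2 := by positivity
        rw [u3, u4]; linarith only [u1, u2, u5, hlogN]
      have t8 : (3 * R1 + 1) * N ≤ K * S * (ε / 6 * ((1 / 4) ^ 2 * p ^ (k - 2) * (1 - p) ^ n)) * N := by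
        calc (3 * R1 + 1) * N ≤ C1 * (n + Real.log μ) * N := by gcongr
          _ = C1 * ((n + Real.log μ) * N) := by ring
          _ ≤ C1 * (2 * (k * S)) := by gcongr
          _ = 2 * C1 * (k * S) := by ring
          _ ≤ _ := by rw [t1]; linarith only [t3, t4, t5]
      exact le_of_mul_le_mul_right t8 hN0
  refine (expOpt_le hp0 (by linarith) hnp hk hkn hμ1 hM hD hmain).trans (ENNReal.ofReal_le_ofReal ?_)
  rw [hNn, ← hS]
  have hk2 : (k:ℝ) ^ 2 * (n:ℝ) ^ 2 ≤ 9 * (N * n) := by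
    have h1 : ((k ^ 2 : ℕ):ℝ) ≤ ((9 * n ^ (k - 3) : ℕ) : ℝ) := by exact_mod_cast k_sq_le (by omega : 2 ≤ n) hk
    push_cast at h1
    have h2 : (N:ℝ) * n = (n:ℝ) ^ (k - 3) * (n:ℝ) ^ 2 := by
      rw [← hNn, ← pow_add]; congr 1; omega
    rw [h2, ← mul_assoc]
    exact mul_le_mul_of_nonneg_right h1 (sq_nonneg _)
  have v1 : 8 * k / (1 - p) ^ n * ((n:ℝ) ^ 2 + 4 * (n * μ)) ≤ 8 * k / a0 * ((n:ℝ) ^ 2 + 4 * (n * μ)) := by gcongr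
  have v2 : k * ((n:ℝ) ^ 2 + 4 * (n * μ)) ≤ 27 * S := by
    have w1 : (k:ℝ) * (n:ℝ) ^ 2 ≤ (k:ℝ) ^ 2 * (n:ℝ) ^ 2 := by
      refine mul_le_mul_of_nonneg_right ?_ (sq_nonneg _)
      nlinarith only [hkR]
    have w2 : 4 * ((k:ℝ) * n * μ) ≤ 2 * ((k:ℝ) ^ 2 * (n:ℝ) ^ 2 + (μ:ℝ) ^ 2) := by
      nlinarith only [sq_nonneg ((k:ℝ) * n - μ)]
    have : 0 ≤ (μ:ℝ) ^ 2 := by positivity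
    have w3 : k * ((n:ℝ) ^ 2 + 4 * (n * μ)) = (k:ℝ) * (n:ℝ) ^ 2 + 4 * ((k:ℝ) * n * μ) := by ring
    rw [hS, w3]; linarith only [w1, w2, hk2, this]
  have v3 : 8 * k / a0 * ((n:ℝ) ^ 2 + 4 * (n * μ)) ≤ 216 / a0 * S := by
    calc 8 * k / a0 * ((n:ℝ) ^ 2 + 4 * (n * μ)) = 8 / a0 * (k * ((n:ℝ) ^ 2 + 4 * (n * μ))) := by ring
      _ ≤ 8 / a0 * (27 * S) := by gcongr
      _ = _ := by ring
  have hN1 : 1 ≤ N := by rw [hN]; exact one_le_pow₀ (by linarith only [hnR])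
  have v4 : A * Q * n ≤ A * Q * S := by
    refine mul_le_mul_of_nonneg_left ?_ (by positivity)
    have : 0 ≤ (μ:ℝ) ^ 2 := by positivity
    have : (n:ℝ) ≤ N * n := le_mul_of_one_le_left hn0.le hN1
    linarith
  have v5 : B * μ * (1 + Real.log μ) ≤ B * S := by
    have h1 : B * μ * (1 + Real.log μ) ≤ B * μ * μ := mul_le_mul_of_nonneg_left (by linarith only [hlog1]) (by positivity)
    have h2 : 0 ≤ B * (N * n) := by positivity
    have h3 : B * S = B * μ * μ + B * (N * n) := by rw [hS]; ring
    linarith only [h1, h2, h3]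
  linarith only [v1, v3, v4, v5, hG0]

/-- Theorem 10 in Dang et al., simplified for k ≥ 3: for 3 ≤ k = o(n),
constant δ > 0 and population size μ ≥ c·k·ln n for a sufficiently large constant
c > 0, the (μ+1) GA with uniform crossover (p_c = 1), mutation rate (1+δ)/n and uniform
tie-breaking has expected optimization time O(μ² + n^(k−1)) on Jump_k. -/
theorem muPlusOneGA_Jump_high_mutation (δ : ℝ) (hδ : 0 < δ) :
    ∃ c : ℝ, 0 < c ∧
      ∀ k μ : ℕ → ℕ, (∀ n, 3 ≤ k n) →
        ((fun n => (k n : ℝ)) =o[atTop] fun n => (n : ℝ)) →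
        (∀ n, 1 ≤ μ n) →
        (∀ᶠ n : ℕ in atTop, c * (k n : ℝ) * Real.log n ≤ (μ n : ℝ)) →
        ∃ C : ℝ, 0 < C ∧ ∀ᶠ n : ℕ in atTop,
          expOpt n (μ n) (k n) ((1 + δ) / n) ≤
            ENNReal.ofReal (C * ((μ n : ℝ) ^ 2 + (n : ℝ) ^ (k n - 1))) := by
  obtain ⟨η, hηd⟩ : ∃ η, η = min δ 1 := ⟨_, rfl⟩
  have hηδ : η ≤ δ := by rw [hηd]; exact min_le_left _ _
  have hη1 : η ≤ 1 := by rw [hηd]; exact min_le_right _ _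
  have hη : 0 < η := by rw [hηd]; exact lt_min hδ one_pos
  obtain ⟨a0, ha0d⟩ : ∃ a0, a0 = Real.exp (-(1 + δ)) / 2 := ⟨_, rfl⟩
  have hexp : Real.exp (-(1 + δ)) ≤ 1 := by rw [Real.exp_le_one_iff]; linarith
  have hexp0 := Real.exp_pos (-(1 + δ))
  have ha0 : 0 < a0 := by rw [ha0d]; positivity
  have ha01 : a0 ≤ 1 := by rw [ha0d]; linarith
  have ha0e : a0 < Real.exp (-(1 + δ)) := by rw [ha0d]; linarith
  obtain ⟨ε, hεd⟩ : ∃ ε, ε = a0 * η / 100 := ⟨_, rfl⟩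
  have hε : 0 < ε := by rw [hεd]; positivity
  obtain ⟨r, hrd⟩ : ∃ r, r = (1 + η / 16) / (1 + η / 8) := ⟨_, rfl⟩
  have hr0 : 0 < r := by rw [hrd]; positivity
  have hr1 : r < 1 := by rw [hrd, div_lt_one (by positivity)]; linarith
  obtain ⟨Λ, hΛd⟩ : ∃ Λ, Λ = -Real.log r := ⟨_, rfl⟩
  have hΛ : 0 < Λ := by rw [hΛd]; have := Real.log_neg hr0 hr1; linarith
  refine ⟨8 / (Λ * ε), by positivity, ?_⟩
  intro k μ hk hko _ hμ
  obtain ⟨C, hC, hfin⟩ := final_pt hηδ hη hη1 ha0 ha01 hε hεd.le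
  refine ⟨C, hC, ?_⟩
  have hθ : 0 < a0 * η / (32 * (1 + δ)) := by positivity
  have hlim : Tendsto (fun n : ℕ => (1 + -(1 + δ) / (n:ℝ)) ^ n) atTop (nhds (Real.exp (-(1 + δ)))) :=
    Real.tendsto_one_add_div_pow_exp _
  have hlog : Tendsto (fun n : ℕ => Real.log (n:ℝ)) atTop atTop := Real.tendsto_log_atTop.comp tendsto_natCast_atTop_atTop
  have hcast : Tendsto (fun n : ℕ => (n:ℝ)) atTop atTop := tendsto_natCast_atTop_atTop
  filter_upwards [hμ, hko.def hθ, hlim.eventually (lt_mem_nhds ha0e), hlog.eventually_ge_atTop Λ,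
    hcast.eventually_ge_atTop (4 * (1 + δ)), hcast.eventually_ge_atTop (4 * (1 + δ) / η),
    hcast.eventually_ge_atTop (2 / a0)] with n hμn hkn hpn hlogn hn1 hn2 hn3
  have hn0 : (0:ℝ) < n := by linarith
  rw [Real.norm_of_nonneg (Nat.cast_nonneg _), Real.norm_of_nonneg (Nat.cast_nonneg _)] at hkn
  have hk3 : (3:ℝ) ≤ k n := by exact_mod_cast hk n
  have haη : a0 * η ≤ η := mul_le_of_le_one_left hη.le ha01
  have hkp : (k n : ℝ) * ((1 + δ) / n) ≤ a0 * η / 32 := by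
    rw [mul_div_assoc', div_le_iff₀ hn0]
    calc (k n : ℝ) * (1 + δ) ≤ (a0 * η / (32 * (1 + δ)) * n) * (1 + δ) := by gcongr
      _ = a0 * η / 32 * n := by field_simp
  have hk2 : 2 * (k n : ℝ) ≤ n := by
    have h1 : a0 * η / (32 * (1 + δ)) ≤ 1 / 2 := by
      rw [div_le_iff₀ (by positivity)]; linarith
    have := mul_le_mul_of_nonneg_right h1 hn0.le
    linarith
  have hp4 : (1 + δ) / n ≤ η / 4 := by
    rw [div_le_iff₀ hη] at hn2
    rw [div_le_iff₀ hn0]; linarith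
  have hμ8 : 3 * 8 * Real.log n ≤ Λ * (ε * μ n) := by
    have h1 : 8 / (Λ * ε) * 3 * Real.log n ≤ 8 / (Λ * ε) * k n * Real.log n := by
      have : 0 ≤ Real.log n := by linarith
      gcongr
    have h2 := mul_le_mul_of_nonneg_left (h1.trans hμn) (by positivity : 0 ≤ Λ * ε)
    have h3 : Λ * ε * (8 / (Λ * ε) * 3 * Real.log n) = 3 * 8 * Real.log n := by field_simp
    rw [h3] at h2
    linarith
  have hμ8' : 8 ≤ ε * μ n := by
    have : Λ * 8 ≤ Λ * (ε * μ n) := by linarith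
    exact le_of_mul_le_mul_left this hΛ
  refine hfin n (k n) (μ n) (hk n) (by exact_mod_cast hk2) _ rfl ?_ ?_ ?_ hkp hμ8' ?_
  · rw [mul_div_assoc', div_le_iff₀ hn0]; linarith
  · refine hpn.le.trans (le_of_eq ?_)
    congr 1; ring
  · have e : ((n:ℝ) - k n - 1) * ((1 + δ) / n) = (1 + δ) - k n * ((1 + δ) / n) - (1 + δ) / n := by
      field_simp
    rw [e]; linarith
  · rw [← hrd]
    set m := ⌊ε * (μ n) / 2⌋₊ - 1 with hm
    have hmge : ε * μ n / 8 ≤ m := by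
      have h1 := Nat.lt_floor_add_one (ε * μ n / 2)
      have h2 : (⌊ε * (μ n) / 2⌋₊ : ℝ) ≤ m + 1 := by
        rw [hm]; exact_mod_cast (by omega)
      linarith
    have h1 : r ^ m ≤ Real.exp (-(2 * Real.log n)) := by
      have : r ^ m = Real.exp (m * Real.log r) := by
        rw [Real.exp_nat_mul, Real.exp_log hr0]
      rw [this, Real.exp_le_exp]
      have h2 := mul_le_mul_of_nonneg_left hmge hΛ.le
      have h3 : (m:ℝ) * Real.log r = -(Λ * m) := by rw [hΛd]; ring
      rw [h3]
      linarith
    have h2 : Real.exp (-(2 * Real.log n)) = ((n:ℝ) ^ 2)⁻¹ := by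
      rw [Real.exp_neg, two_mul, Real.exp_add, Real.exp_log hn0, sq]
    rw [h2] at h1
    calc 2 / a0 * n * r ^ m ≤ n * n * ((n:ℝ) ^ 2)⁻¹ := by gcongr
      _ = 1 := by field_simp


end Jump
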